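/- Let 0 < λ ≤ 2, ν > 0 and ν + λ > 1. Then for every φ ∈ (0,π), | (sin φ)^λ · ʳG_ν^{(λ)}(cos φ) − (2^λ Γ(λ+1/2))/(√π (ν+λ)^λ) · cos((ν+λ)φ − λπ/2) | ≤ B/(ν^{λ+1} sin φ), where B = (λ |λ−1| 2^λ Γ(λ+1/2)/√π) · ((3ν+5λ−1)/(3(ν+λ−1))) · exp((1−λ²)/(ν+λ−1)). -/

import Mathlib

open Real

/-- Pochhammer symbol `(a)_n = a (a+1) ⋯ (a+n-1)` for a real base. -/
noncomputable def poch (a : ℝ) (n : ℕ) : ℝ := ∏ i ∈ Finset.range n, (a + (i : ℝ))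

/-- The right generalized Gegenbauer function of fractional degree. -/
noncomputable def rG (lam nu x : ℝ) : ℝ :=
  ∑' j : ℕ, (poch (-nu) j * poch (nu + 2 * lam) j /
    ((j.factorial : ℝ) * poch (lam + 1 / 2) j)) * ((1 - x) / 2) ^ j

open PowerSeries in
/-- evaluation of a real power series -/
noncomputable def ev (p : PowerSeries ℝ) (x : ℝ) : ℝ := ∑' n, coeff n p * x ^ n

/-- absolute convergence on the unit interval -/
def Conv (p : PowerSeries ℝ) : Prop :=
  ∀ x : ℝ, |x| < 1 → Summable fun n => ‖PowerSeries.coeff n p * x ^ n‖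

lemma Conv.add {p q : PowerSeries ℝ} (hp : Conv p) (hq : Conv q) : Conv (p + q) := by
  intro x hx
  refine Summable.of_nonneg_of_le (fun _ => norm_nonneg _) (fun n => ?_) ((hp x hx).add (hq x hx))
  rw [map_add, add_mul]; exact norm_add_le _ _

lemma Conv.mul {p q : PowerSeries ℝ} (hp : Conv p) (hq : Conv q) : Conv (p * q) := by
  intro x hx
  have h := summable_norm_sum_mul_antidiagonal_of_summable_norm (hp x hx) (hq x hx)
  refine h.congr fun n => ?_
  rw [PowerSeries.coeff_mul, Finset.sum_mul]
  congr 1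
  refine Finset.sum_congr rfl fun ij hij => ?_
  rw [← Finset.HasAntidiagonal.mem_antidiagonal.1 hij, pow_add]; ring

lemma ev_add {p q : PowerSeries ℝ} (hp : Conv p) (hq : Conv q) {x : ℝ} (hx : |x| < 1) :
    ev (p + q) x = ev p x + ev q x := by
  unfold ev
  rw [← Summable.tsum_add (hp x hx).of_norm (hq x hx).of_norm]
  refine tsum_congr fun n => ?_
  rw [map_add, add_mul]

lemma ev_mul {p q : PowerSeries ℝ} (hp : Conv p) (hq : Conv q) {x : ℝ} (hx : |x| < 1) :
    ev (p * q) x = ev p x * ev q x := by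
  unfold ev
  rw [tsum_mul_tsum_eq_tsum_sum_antidiagonal_of_summable_norm (hp x hx) (hq x hx)]
  refine tsum_congr fun n => ?_
  rw [PowerSeries.coeff_mul, Finset.sum_mul]
  refine Finset.sum_congr rfl fun ij hij => ?_
  rw [← Finset.HasAntidiagonal.mem_antidiagonal.1 hij, pow_add]; ring

lemma conv_C (a : ℝ) : Conv (PowerSeries.C a) := by
  intro x hx
  refine summable_of_ne_finset_zero (s := {0}) fun n hn => ?_
  have : n ≠ 0 := by simpa using hn
  simp [PowerSeries.coeff_C, this]

lemma conv_X : Conv (PowerSeries.X) := by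
  intro x hx
  refine summable_of_ne_finset_zero (s := {1}) fun n hn => ?_
  have : n ≠ 1 := by simpa using hn
  simp [PowerSeries.coeff_X, this]

lemma ev_C (a x : ℝ) : ev (PowerSeries.C a) x = a := by
  unfold ev
  rw [tsum_eq_single 0]
  · simp
  · intro n hn; simp [PowerSeries.coeff_C, hn]

lemma ev_X (x : ℝ) : ev (PowerSeries.X) x = x := by
  unfold ev
  rw [tsum_eq_single 1]
  · simp
  · intro n hn; simp [PowerSeries.coeff_X, hn]

lemma ev_zero (p : PowerSeries ℝ) : ev p 0 = PowerSeries.coeff 0 p := by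
  unfold ev
  rw [tsum_eq_single 0]
  · simp
  · intro n hn; simp [hn]

open PowerSeries in
lemma Conv.deriv {p : PowerSeries ℝ} (hp : Conv p) : Conv (derivative ℝ p) := by
  intro x hx
  obtain ⟨r, hxr, hr1⟩ := exists_between hx
  have hr0 : 0 < r := (abs_nonneg x).trans_lt hxr
  have hS := hp r (by rwa [abs_of_pos hr0])
  have hS1 := (summable_nat_add_iff 1).2 hS
  have ht : Filter.Tendsto (fun n : ℕ => (n : ℝ) * (|x| / r) ^ n) Filter.atTop (nhds 0) :=
    tendsto_self_mul_const_pow_of_lt_one (by positivity) ((div_lt_one hr0).2 hxr)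
  have ht2 : Filter.Tendsto (fun n : ℕ => (|x| / r) ^ n) Filter.atTop (nhds 0) :=
    tendsto_pow_atTop_nhds_zero_of_lt_one (by positivity) ((div_lt_one hr0).2 hxr)
  have ht3 := ht.add ht2
  rw [add_zero] at ht3
  have hev := ht3.eventually (gt_mem_nhds (show (0:ℝ) < 1 by norm_num))
  refine Summable.of_norm_bounded_eventually_nat (hS1.mul_left (1 / r)) ?_
  filter_upwards [hev] with n hn
  rw [norm_norm, coeff_derivative, norm_mul, norm_mul, norm_mul, norm_pow, norm_pow]
  simp only [Real.norm_eq_abs]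
  rw [abs_of_pos hr0, abs_of_pos (show (0:ℝ) < n + 1 by positivity)]
  have h1 : ((n : ℝ) + 1) * |x| ^ n ≤ r ^ n := by
    have : ((n : ℝ) + 1) * (|x| / r) ^ n ≤ 1 := by linarith
    rw [div_pow, ← mul_div_assoc, div_le_one (by positivity)] at this
    exact this
  calc |coeff (n + 1) p| * ((n : ℝ) + 1) * |x| ^ n
      = |coeff (n + 1) p| * (((n : ℝ) + 1) * |x| ^ n) := by ring
    _ ≤ |coeff (n + 1) p| * r ^ n := by gcongr
    _ = 1 / r * (|coeff (n + 1) p| * r ^ (n + 1)) := by rw [pow_succ]; field_simp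

open PowerSeries in
lemma ev_hasDerivAt {p : PowerSeries ℝ} (hp : Conv p) {x : ℝ} (hx : |x| < 1) :
    HasDerivAt (ev p) (ev (derivative ℝ p) x) x := by
  obtain ⟨r, hxr, hr1⟩ := exists_between hx
  have hr0 : 0 < r := (abs_nonneg x).trans_lt hxr
  have hS := hp.deriv r (by rwa [abs_of_pos hr0])
  have key : HasDerivAt (fun y => ∑' n, coeff (n + 1) p * y ^ (n + 1))
      (∑' n, coeff n (derivative ℝ p) * x ^ n) x := by
    refine hasDerivAt_tsum_of_isPreconnected (t := Metric.ball 0 r) (y₀ := 0)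
      (g' := fun n y => coeff n (derivative ℝ p) * y ^ n) hS Metric.isOpen_ball
      (convex_ball _ _).isPreconnected ?_ ?_ ?_ ?_ ?_
    · intro n y hy
      have := (hasDerivAt_pow (n + 1) y).const_mul (coeff (n + 1) p)
      convert! this using 1
      rw [coeff_derivative, Nat.add_sub_cancel]; push_cast; ring
    · intro n y hy
      rw [norm_mul, norm_mul, norm_pow, norm_pow]
      have : ‖y‖ ≤ ‖r‖ := by
        rw [Real.norm_eq_abs r, abs_of_pos hr0]; exact (by simpa using hy : |y| < r).le
      gcongr
    · simpa using hr0
    · simp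
    · simpa using hxr
  have h2 : HasDerivAt (fun y => coeff 0 p + ∑' n, coeff (n + 1) p * y ^ (n + 1))
      (∑' n, coeff n (derivative ℝ p) * x ^ n) x := by
    simpa using key.const_add (coeff 0 p)
  refine h2.congr_of_eventuallyEq ?_
  have : ∀ᶠ y : ℝ in nhds x, |y| < 1 := (continuous_abs.tendsto x).eventually (gt_mem_nhds hx)
  filter_upwards [this] with y hy
  unfold ev
  rw [(hp y hy).of_norm.tsum_eq_zero_add]; simp

lemma poch_succ (a : ℝ) (n : ℕ) : poch a (n + 1) = poch a n * (a + n) := by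
  unfold poch; rw [Finset.prod_range_succ]

lemma poch_zero (a : ℝ) : poch a 0 = 1 := by simp [poch]

lemma poch_pos {a : ℝ} (ha : 0 < a) (n : ℕ) : 0 < poch a n := by
  unfold poch; exact Finset.prod_pos fun i _ => by positivity

/-- hypergeometric series -/
noncomputable def hyp (a b c : ℝ) : PowerSeries ℝ :=
  PowerSeries.mk fun n => poch a n * poch b n / ((n.factorial : ℝ) * poch c n)

lemma hyp_coeff_succ (a b : ℝ) {c : ℝ} (hc : 0 < c) (n : ℕ) :
    ((n : ℝ) + 1) * (c + n) * PowerSeries.coeff (n + 1) (hyp a b c) =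
      (a + n) * (b + n) * PowerSeries.coeff n (hyp a b c) := by
  simp only [hyp, PowerSeries.coeff_mk, poch_succ, Nat.factorial_succ]
  have := poch_pos hc n
  have : (n.factorial : ℝ) ≠ 0 := by positivity
  have : c + n ≠ 0 := by positivity
  push_cast
  field_simp

lemma conv_hyp (a b : ℝ) {c : ℝ} (hc : 0 < c) : Conv (hyp a b c) := by
  intro x hx
  obtain ⟨r, hxr, hr1⟩ := exists_between hx
  refine Summable.norm ?_
  have hlim : Filter.Tendsto (fun n : ℕ => (a + n) * (b + n) / (((n : ℝ) + 1) * (c + n)) * x)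
      Filter.atTop (nhds (1 * 1 * x)) := by
    have h1 := tendsto_add_mul_div_add_mul_atTop_nhds a (1:ℝ) 1 (one_ne_zero) (𝕜 := ℝ)
    have h2 := tendsto_add_mul_div_add_mul_atTop_nhds b c 1 (one_ne_zero) (𝕜 := ℝ)
    have := (h1.mul h2).mul_const x
    simp only [one_mul, div_one] at this
    simp only [one_mul]
    refine this.congr fun n => ?_
    rw [div_mul_div_comm, add_comm (1:ℝ) n]
  have hev := (hlim.norm).eventually (gt_mem_nhds (show ‖1 * 1 * x‖ < r by simpa using hxr))
  refine summable_of_ratio_norm_eventually_le (r := r) hr1 ?_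
  filter_upwards [hev] with n hn
  have h := hyp_coeff_succ a b hc n
  have hp : (0:ℝ) < ((n : ℝ) + 1) * (c + n) := by positivity
  have h3 : PowerSeries.coeff (n + 1) (hyp a b c) * x ^ (n + 1) =
     ((a + n) * (b + n) / (((n : ℝ) + 1) * (c + n)) * x) * (PowerSeries.coeff n (hyp a b c) * x ^ n) := by
    rw [mul_comm, ← eq_div_iff hp.ne'] at h
    rw [h, pow_succ]; field_simp
  rw [h3, norm_mul]
  gcongr

open PowerSeries in
lemma ode_coeff (p : PowerSeries ℝ) (a b c : ℝ) (n : ℕ) :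
    coeff n (X * (1 - X) * derivative ℝ (derivative ℝ p) +
      (C c - C (a + b + 1) * X) * derivative ℝ p - C (a * b) * p) =
    ((n : ℝ) + 1) * (c + n) * coeff (n + 1) p - (a + n) * (b + n) * coeff n p := by
  have e : X * (1 - X) * derivative ℝ (derivative ℝ p) +
      (C c - C (a + b + 1) * X) * derivative ℝ p - C (a * b) * p =
      X * derivative ℝ (derivative ℝ p) - X * (X * derivative ℝ (derivative ℝ p)) +
      C c * derivative ℝ p - C (a + b + 1) * (X * derivative ℝ p) - C (a * b) * p := by ring
  rw [e]
  obtain ⟨k1, hk1⟩ : ∃ k, k = a + b + 1 := ⟨_, rfl⟩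
  obtain ⟨k2, hk2⟩ : ∃ k, k = a * b := ⟨_, rfl⟩
  rw [← hk1, ← hk2]
  rcases n with _ | _ | n
  · simp only [map_sub, map_add, coeff_C_mul, coeff_zero_X_mul, coeff_derivative]
    push_cast; rw [hk2]; ring
  · simp only [map_sub, map_add, coeff_succ_X_mul, coeff_C_mul, coeff_zero_X_mul, coeff_derivative]
    push_cast; rw [hk1, hk2]; ring
  · simp only [map_sub, map_add, coeff_succ_X_mul, coeff_C_mul, coeff_derivative]
    push_cast; rw [hk1, hk2]; ring

open PowerSeries in
lemma hyp_ode (a b : ℝ) {c : ℝ} (hc : 0 < c) :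
    X * (1 - X) * derivative ℝ (derivative ℝ (hyp a b c)) +
      (C c - C (a + b + 1) * X) * derivative ℝ (hyp a b c) - C (a * b) * (hyp a b c) = 0 := by
  ext n
  rw [ode_coeff, hyp_coeff_succ a b hc]; simp

open PowerSeries in
lemma hyp_unique (a b : ℝ) {c : ℝ} (hc : 0 < c) (p : PowerSeries ℝ) (h0 : coeff 0 p = 1)
    (h : X * (1 - X) * derivative ℝ (derivative ℝ p) +
      (C c - C (a + b + 1) * X) * derivative ℝ p - C (a * b) * p = 0) : p = hyp a b c := by
  ext n
  induction n with
  | zero => rw [h0]; simp [hyp, poch_zero]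
  | succ n ih =>
    have h1 := ode_coeff p a b c n
    rw [h] at h1
    have h2 := hyp_coeff_succ a b hc n
    have hp : (0:ℝ) < ((n : ℝ) + 1) * (c + n) := by positivity
    apply mul_left_cancel₀ hp.ne'
    rw [h2, ← ih]
    simp at h1; linarith

open PowerSeries in
lemma binom_ode (s : ℝ) : (1 - X) * derivative ℝ (hyp (-s) 1 1) = - (C s * hyp (-s) 1 1) := by
  ext n
  have h := hyp_coeff_succ (-s) 1 one_pos n
  have h' : ((n : ℝ) + 1) * coeff (n + 1) (hyp (-s) 1 1) = (-s + n) * coeff n (hyp (-s) 1 1) := by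
    have : (0:ℝ) < (n : ℝ) + 1 := by positivity
    apply mul_left_cancel₀ this.ne'
    linarith
  rw [sub_mul, one_mul, map_sub, map_neg, coeff_C_mul, coeff_derivative]
  rcases n with _ | n
  · simp at h' ⊢; linarith
  · rw [coeff_succ_X_mul, coeff_derivative]; push_cast at h' ⊢; linarith

open PowerSeries in
lemma euler_formal (a b : ℝ) {c : ℝ} (hc : 0 < c) :
    hyp (-(c - a - b)) 1 1 * hyp (c - a) (c - b) c = hyp a b c := by
  set s := c - a - b with hs
  set B := hyp (-s) 1 1 with hB
  set H := hyp (c - a) (c - b) c with hH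
  have hb : (1 - X) * derivative ℝ B = - (C s * B) := binom_ode s
  have hb2 : derivative ℝ ((1 - X) * derivative ℝ B) = - (C s * derivative ℝ B) := by
    rw [hb]; simp
  have hb3 : (1 - X) * derivative ℝ (derivative ℝ B) = (1 - C s) * derivative ℝ B := by
    rw [Derivation.leibniz] at hb2
    simp at hb2
    linear_combination hb2
  have hh := hyp_ode (c - a) (c - b) hc
  rw [← hH] at hh
  have hCs : (C s : PowerSeries ℝ) = C c - C a - C b := by rw [hs]; simp
  have hone : (C (1:ℝ) : PowerSeries ℝ) = 1 := by simp
  refine hyp_unique a b hc _ ?_ ?_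
  · simp [B, H, hyp, poch_zero, coeff_mul]
  · have hne : (1 - X : PowerSeries ℝ) ≠ 0 := by
      intro h
      have := congrArg (constantCoeff) h
      simp at this
    apply mul_left_cancel₀ hne
    simp only [map_add, map_sub, map_mul, hone, Derivation.leibniz, smul_eq_mul] at hh ⊢
    rw [hCs] at hb hb3
    linear_combination (X * (1 - X) * H) * hb3 + (X * (1 - (C c - C a - C b)) * H) * hb +
      (2 * X * (1 - X) * derivative ℝ H) * hb + ((C c - (C a + C b + 1) * X) * H) * hb +
      ((1 - X) * B) * hh

lemma binom_ev (s : ℝ) {x : ℝ} (hx : |x| < 1) : ev (hyp (-s) 1 1) x = (1 - x) ^ s := by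
  have hode : ∀ y : ℝ, |y| < 1 →
      (1 - y) * ev (PowerSeries.derivative ℝ (hyp (-s) 1 1)) y = - s * ev (hyp (-s) 1 1) y := by
    intro y hy
    have h := congrArg (fun p => ev p y) (binom_ode s)
    have e1 : (1 - PowerSeries.X : PowerSeries ℝ) =
        PowerSeries.C 1 + PowerSeries.C (-1) * PowerSeries.X := by simp; ring
    have e2 : - (PowerSeries.C s * hyp (-s) 1 1) = PowerSeries.C (-s) * hyp (-s) 1 1 := by simp
    have c1 := conv_hyp (-s) 1 one_pos
    simp only [e1, e2] at h
    rw [ev_mul ((conv_C _).add ((conv_C _).mul conv_X)) c1.deriv hy,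
      ev_add (conv_C _) ((conv_C _).mul conv_X) hy, ev_mul (conv_C _) conv_X hy,
      ev_mul (conv_C _) c1 hy, ev_C, ev_C, ev_C, ev_X] at h
    linarith
  have hd : ∀ y ∈ Set.Ioo (-1 : ℝ) 1,
      HasDerivAt (fun y => ev (hyp (-s) 1 1) y * (1 - y) ^ (-s)) 0 y := by
    intro y hy
    have hy' : |y| < 1 := abs_lt.2 hy
    have hpos : 0 < 1 - y := by linarith [hy.2]
    have h1 := ev_hasDerivAt (conv_hyp (-s) 1 one_pos) hy'
    have h2 : HasDerivAt (fun y : ℝ => (1 - y) ^ (-s)) (-1 * (-s) * (1 - y) ^ (-s - 1)) y :=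
      ((hasDerivAt_id y).const_sub 1).rpow_const (Or.inl hpos.ne')
    convert! h1.mul h2 using 1
    have h3 := hode y hy'
    rw [Real.rpow_sub_one hpos.ne']
    have h4 : ev (PowerSeries.derivative ℝ (hyp (-s) 1 1)) y
      = - s * ev (hyp (-s) 1 1) y / (1 - y) := by
      rw [eq_div_iff hpos.ne']; linarith
    rw [h4]; field_simp; ring
  have hx' := abs_lt.1 hx
  have hpos : 0 < 1 - x := by linarith [hx'.2]
  have h := isOpen_Ioo.is_const_of_deriv_eq_zero (convex_Ioo (-1 : ℝ) 1).isPreconnected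
    (fun y hy => (hd y hy).differentiableAt.differentiableWithinAt)
    (fun y hy => (hd y hy).deriv) (show x ∈ Set.Ioo (-1 : ℝ) 1 from hx')
    (show (0:ℝ) ∈ Set.Ioo (-1 : ℝ) 1 by norm_num)
  have h00 : PowerSeries.coeff 0 (hyp (-s) 1 1) = 1 := by simp [hyp, poch_zero]
  simp only [ev_zero, h00, sub_zero, Real.one_rpow, mul_one] at h
  rw [Real.rpow_neg hpos.le] at h
  have : (1 - x) ^ s ≠ 0 := (Real.rpow_pos_of_pos hpos s).ne'
  field_simp at h
  exact h

lemma euler (a b : ℝ) {c : ℝ} (hc : 0 < c) {x : ℝ} (hx : |x| < 1) :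
    ev (hyp a b c) x = (1 - x) ^ (c - a - b) * ev (hyp (c - a) (c - b) c) x := by
  rw [← euler_formal a b hc, ev_mul (conv_hyp _ _ one_pos) (conv_hyp _ _ hc) hx, binom_ev _ hx]

lemma cos_expand_ode (N : ℝ) {y : ℝ} (hy : |y| < 1) :
    y * (1 - y) * ev (PowerSeries.derivative ℝ (PowerSeries.derivative ℝ
        (hyp (1/2 + N) (1/2 - N) (1/2)))) y +
      (1/2 - 2 * y) * ev (PowerSeries.derivative ℝ (hyp (1/2 + N) (1/2 - N) (1/2))) y -
      (1/4 - N ^ 2) * ev (hyp (1/2 + N) (1/2 - N) (1/2)) y = 0 := by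
  have hc : (0:ℝ) < 1/2 := by norm_num
  have h := congrArg (fun p => ev p y) (hyp_ode (1/2 + N) (1/2 - N) hc)
  have c0 := conv_hyp (1/2 + N) (1/2 - N) hc
  set H := hyp (1/2 + N) (1/2 - N) (1/2) with hH
  have e : PowerSeries.X * (1 - PowerSeries.X) * PowerSeries.derivative ℝ (PowerSeries.derivative ℝ H) +
      (PowerSeries.C (1/2) - PowerSeries.C ((1/2 + N) + (1/2 - N) + 1) * PowerSeries.X) *
        PowerSeries.derivative ℝ H - PowerSeries.C ((1/2 + N) * (1/2 - N)) * H =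
      PowerSeries.X * ((PowerSeries.C 1 + PowerSeries.C (-1) * PowerSeries.X) *
        PowerSeries.derivative ℝ (PowerSeries.derivative ℝ H)) +
      ((PowerSeries.C (1/2) + PowerSeries.C (-2) * PowerSeries.X) *
        PowerSeries.derivative ℝ H + PowerSeries.C (N ^ 2 - 1/4) * H) := by
    have e1 : (1/2 + N) + (1/2 - N) + 1 = 2 := by ring
    have e2 : (1/2 + N) * (1/2 - N) = -(N^2 - 1/4) := by ring
    rw [e1, e2, map_neg, map_neg, map_neg, map_one]; ring
  have l1 (a b : ℝ) : Conv (PowerSeries.C a + PowerSeries.C b * PowerSeries.X) :=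
    (conv_C _).add ((conv_C _).mul conv_X)
  have l2 (a b : ℝ) : ev (PowerSeries.C a + PowerSeries.C b * PowerSeries.X) y = a + b * y := by
    rw [ev_add (conv_C _) ((conv_C _).mul conv_X) hy, ev_mul (conv_C _) conv_X hy, ev_C, ev_C, ev_X]
  have l3 : ev (0 : PowerSeries ℝ) y = 0 := by simp [ev]
  simp only [e] at h
  rw [ev_add (conv_X.mul ((l1 _ _).mul c0.deriv.deriv)) (((l1 _ _).mul c0.deriv).add
    ((conv_C _).mul c0)) hy, ev_mul conv_X ((l1 _ _).mul c0.deriv.deriv) hy,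
    ev_mul (l1 _ _) c0.deriv.deriv hy, ev_add ((l1 _ _).mul c0.deriv) ((conv_C _).mul c0) hy,
    ev_mul (l1 _ _) c0.deriv hy, ev_mul (conv_C _) c0 hy, l2, l2, ev_C, ev_X, l3] at h
  linear_combination h

lemma cos_expand {N : ℝ} (hN : N ≠ 0) {t : ℝ} (ht : t ∈ Set.Ioo (-π) π) :
    cos (t / 2) * ev (hyp (1/2 + N) (1/2 - N) (1/2)) (sin (t / 2) ^ 2) = cos (N * t) := by
  have hc : (0:ℝ) < 1/2 := by norm_num
  have c0 := conv_hyp (1/2 + N) (1/2 - N) hc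
  have hode := fun y hy => cos_expand_ode N (y := y) hy
  set H := hyp (1/2 + N) (1/2 - N) (1/2) with hH
  set S := ev H with hS
  set S1 := ev (PowerSeries.derivative ℝ H) with hS1
  set S2 := ev (PowerSeries.derivative ℝ (PowerSeries.derivative ℝ H)) with hS2
  have hlt : ∀ t ∈ Set.Ioo (-π) π, |sin (t / 2) ^ 2| < 1 := by
    intro t ht
    have : 0 < cos (t / 2) := cos_pos_of_mem_Ioo ⟨by linarith [ht.1], by linarith [ht.2]⟩
    rw [abs_of_nonneg (sq_nonneg _)]
    nlinarith [sin_sq_add_cos_sq (t / 2)]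
  have dhalf : ∀ t : ℝ, HasDerivAt (fun t : ℝ => t / 2) (1 / 2) t := fun t =>
    (hasDerivAt_id t).div_const 2
  have dsin : ∀ t : ℝ, HasDerivAt (fun t : ℝ => sin (t / 2)) (cos (t / 2) * (1 / 2)) t := fun t =>
    (dhalf t).sin
  have dcos : ∀ t : ℝ, HasDerivAt (fun t : ℝ => cos (t / 2)) (-sin (t / 2) * (1 / 2)) t := fun t =>
    (dhalf t).cos
  have dy : ∀ t : ℝ, HasDerivAt (fun t : ℝ => sin (t / 2) ^ 2) (sin (t / 2) * cos (t / 2)) t := by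
    intro t
    convert! (dsin t).pow 2 using 1
    push_cast; ring
  have dS : ∀ t ∈ Set.Ioo (-π) π, HasDerivAt (fun t : ℝ => S (sin (t / 2) ^ 2))
      (S1 (sin (t / 2) ^ 2) * (sin (t / 2) * cos (t / 2))) t := fun t ht =>
    HasDerivAt.comp t (ev_hasDerivAt c0 (hlt t ht)) (dy t)
  have dS1 : ∀ t ∈ Set.Ioo (-π) π, HasDerivAt (fun t : ℝ => S1 (sin (t / 2) ^ 2))
      (S2 (sin (t / 2) ^ 2) * (sin (t / 2) * cos (t / 2))) t := fun t ht =>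
    HasDerivAt.comp t (ev_hasDerivAt c0.deriv (hlt t ht)) (dy t)
  set g : ℝ → ℝ := fun t => cos (t / 2) * S (sin (t / 2) ^ 2) with hg
  set g1 : ℝ → ℝ := fun t => -sin (t / 2) * (1 / 2) * S (sin (t / 2) ^ 2) +
    cos (t / 2) * (S1 (sin (t / 2) ^ 2) * (sin (t / 2) * cos (t / 2))) with hg1
  have dg : ∀ t ∈ Set.Ioo (-π) π, HasDerivAt g (g1 t) t := fun t ht => (dcos t).mul (dS t ht)
  have dg1 : ∀ t ∈ Set.Ioo (-π) π, HasDerivAt g1 (-N ^ 2 * g t) t := by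
    intro t ht
    have h1 := ((((dsin t).neg).mul_const (1/2)).mul (dS t ht)).add
      ((dcos t).mul ((dS1 t ht).mul ((dsin t).mul (dcos t))))
    convert! h1 using 1
    have h2 := hode _ (hlt t ht)
    have h3 := sin_sq_add_cos_sq (t / 2)
    simp only [hg, Pi.neg_apply, Pi.mul_apply]
    generalize S (sin (t / 2) ^ 2) = s0 at *
    generalize S1 (sin (t / 2) ^ 2) = s1 at *
    generalize S2 (sin (t / 2) ^ 2) = s2 at *
    have h4 : cos (t / 2) ^ 2 = 1 - sin (t / 2) ^ 2 := by linarith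
    generalize sin (t / 2) = x at *
    generalize cos (t / 2) = c at *
    have h5 : c ^ 3 = c * (1 - x ^ 2) := by rw [← h4]; ring
    linear_combination (-c) * h2 - (s1 / 2 + s2 * x ^ 2) * h5
  have dE : ∀ t ∈ Set.Ioo (-π) π, HasDerivAt
      (fun t => (g1 t + N * sin (N * t)) ^ 2 + N ^ 2 * (g t - cos (N * t)) ^ 2) 0 t := by
    intro t ht
    have dN : HasDerivAt (fun t : ℝ => N * t) N t := by simpa using (hasDerivAt_id t).const_mul N
    have h1 := (((dg1 t ht).add (dN.sin.const_mul N)).pow 2).add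
      ((((dg t ht).sub dN.cos).pow 2).const_mul (N ^ 2))
    convert! h1 using 1
    simp only [Pi.add_apply, Pi.sub_apply]
    push_cast
    ring
  have h := isOpen_Ioo.is_const_of_deriv_eq_zero (convex_Ioo (-π) π).isPreconnected
    (fun y hy => (dE y hy).differentiableAt.differentiableWithinAt)
    (fun y hy => (dE y hy).deriv) ht
    (show (0:ℝ) ∈ Set.Ioo (-π) π from ⟨by linarith [pi_pos], pi_pos⟩)
  have h00 : S 0 = 1 := by rw [hS, ev_zero]; simp [hH, hyp, poch_zero]
  have hg0 : g 0 = 1 := by simp [hg, h00]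
  have hg10 : g1 0 = 0 := by simp [hg1]
  simp only [hg0, hg10] at h
  simp only [mul_zero, sin_zero, cos_zero, sub_self, add_zero] at h
  norm_num at h
  have hN2 : 0 < N ^ 2 := by positivity
  have h6 : N ^ 2 * (g t - cos (N * t)) ^ 2 = 0 := by
    have := sq_nonneg (g1 t + N * sin (N * t))
    have := mul_nonneg hN2.le (sq_nonneg (g t - cos (N * t)))
    linarith
  have h7 : (g t - cos (N * t)) ^ 2 = 0 := by
    rcases mul_eq_zero.1 h6 with h | h
    · exact absurd h hN2.ne'
    · exact h
  have := pow_eq_zero_iff (two_ne_zero) |>.1 h7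
  show g t = _
  linarith

open MeasureTheory in
lemma real_beta {a b : ℝ} (ha : 0 < a) (hb : 0 < b) :
    IntegrableOn (fun y : ℝ => y ^ (a - 1) * (1 - y) ^ (b - 1)) (Set.Ioo 0 1) ∧
    ∫ y in Set.Ioo (0:ℝ) 1, y ^ (a - 1) * (1 - y) ^ (b - 1) =
      Gamma a * Gamma b / Gamma (a + b) := by
  have hI := Complex.betaIntegral_convergent (u := a) (v := b) (by simpa) (by simpa)
  have hcast : ∀ y ∈ Set.Ioo (0:ℝ) 1, (y : ℂ) ^ ((a : ℂ) - 1) * (1 - (y : ℂ)) ^ ((b : ℂ) - 1) =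
      ((y ^ (a - 1) * (1 - y) ^ (b - 1) : ℝ) : ℂ) := by
    intro y hy
    have h1 : (1 - (y : ℂ)) = ((1 - y : ℝ) : ℂ) := by push_cast; ring
    rw [h1, Complex.ofReal_mul, Complex.ofReal_cpow hy.1.le, Complex.ofReal_cpow (by linarith [hy.2])]
    push_cast; rfl
  rw [intervalIntegrable_iff_integrableOn_Ioo_of_le zero_le_one] at hI
  have hI2 := (hI.congr_fun hcast measurableSet_Ioo)
  have hI3 : IntegrableOn (fun y : ℝ => y ^ (a - 1) * (1 - y) ^ (b - 1)) (Set.Ioo 0 1) := by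
    have h := hI2.re
    simp only [RCLike.re_to_complex, Complex.ofReal_re] at h
    exact h
  refine ⟨hI3, ?_⟩
  have h2 := ProbabilityTheory.beta_eq_betaIntegralReal a b ha hb
  rw [ProbabilityTheory.beta, Complex.betaIntegral, intervalIntegral.integral_of_le zero_le_one,
    integral_Ioc_eq_integral_Ioo, setIntegral_congr_fun measurableSet_Ioo hcast,
    integral_complex_ofReal, Complex.ofReal_re] at h2
  exact h2.symm

lemma gamma_poch {a : ℝ} (ha : 0 < a) (n : ℕ) : Gamma (a + n) = poch a n * Gamma a := by
  induction n with
  | zero => simp [poch_zero]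
  | succ n ih =>
    push_cast
    rw [← add_assoc, Gamma_add_one (by positivity), ih, poch_succ]; ring

lemma cos_eq_half (t : ℝ) : cos t = 1 - 2 * sin (t / 2) ^ 2 := by
  have h := cos_two_mul (t / 2)
  have h3 := sin_sq_add_cos_sq (t / 2)
  rw [show 2 * (t / 2) = t by ring] at h
  linarith

lemma cos_sub_cos_half (t φ : ℝ) : cos t - cos φ = 2 * (sin (φ / 2) ^ 2 - sin (t / 2) ^ 2) := by
  rw [cos_eq_half t, cos_eq_half φ]; ring

lemma sin_half_lt {t φ : ℝ} (hφ : φ ∈ Set.Ioo 0 π) (ht : t ∈ Set.Ioo 0 φ) :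
    0 < sin (t / 2) ∧ sin (t / 2) < sin (φ / 2) := by
  have := hφ.1; have := hφ.2; have := ht.1; have := ht.2
  exact ⟨sin_pos_of_pos_of_lt_pi (by linarith) (by linarith),
    sin_lt_sin_of_lt_of_le_pi_div_two (by linarith) (by linarith) (by linarith)⟩

lemma cv_image {φ : ℝ} (hφ : φ ∈ Set.Ioo 0 π) :
    (fun t => sin (t / 2) ^ 2 / sin (φ / 2) ^ 2) '' Set.Ioo 0 φ = Set.Ioo 0 1 := by
  have h1 := hφ.1
  have h2 := hφ.2
  have hs : 0 < sin (φ / 2) := sin_pos_of_pos_of_lt_pi (by linarith) (by linarith)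
  ext y
  constructor
  · rintro ⟨t, ht, rfl⟩
    obtain ⟨h3, h4⟩ := sin_half_lt hφ ht
    refine ⟨by positivity, ?_⟩
    simp only
    rw [div_lt_one (by positivity)]
    gcongr
  · rintro ⟨hy0, hy1⟩
    have hq0 : 0 < √y := sqrt_pos.2 hy0
    have hq1 : √y < 1 := by rw [sqrt_lt' one_pos]; simpa using hy1
    have hlt : sin (φ / 2) * √y < sin (φ / 2) := by nlinarith
    have hs1 := sin_le_one (φ / 2)
    refine ⟨2 * arcsin (sin (φ / 2) * √y), ⟨?_, ?_⟩, ?_⟩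
    · have : 0 < arcsin (sin (φ / 2) * √y) := arcsin_pos.2 (by positivity)
      linarith
    · have : arcsin (sin (φ / 2) * √y) < arcsin (sin (φ / 2)) :=
        arcsin_lt_arcsin (by nlinarith) hlt hs1
      rw [arcsin_sin (by linarith) (by linarith)] at this
      linarith
    · have e : 2 * arcsin (sin (φ / 2) * √y) / 2 = arcsin (sin (φ / 2) * √y) := by ring
      simp only
      rw [e, sin_arcsin (by nlinarith) (by linarith), mul_pow, sq_sqrt hy0.le]
      field_simp

lemma cv_inj {φ : ℝ} (hφ : φ ∈ Set.Ioo 0 π) :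
    Set.InjOn (fun t => sin (t / 2) ^ 2 / sin (φ / 2) ^ 2) (Set.Ioo 0 φ) := by
  have h1 := hφ.1
  have h2 := hφ.2
  have hs : 0 < sin (φ / 2) := sin_pos_of_pos_of_lt_pi (by linarith) (by linarith)
  intro a ha b hb hab
  have ha1 := sin_half_lt hφ ha
  have hb1 := sin_half_lt hφ hb
  simp only at hab
  rw [div_left_inj' (by positivity)] at hab
  have h3 : sin (a / 2) = sin (b / 2) := by
    rw [pow_left_inj₀ ha1.1.le hb1.1.le two_ne_zero] at hab; exact hab
  have h4 := injOn_sin (show a / 2 ∈ Set.Icc (-(π / 2)) (π / 2) from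
    ⟨by linarith [ha.1], by linarith [ha.2]⟩) (show b / 2 ∈ Set.Icc (-(π / 2)) (π / 2) from
    ⟨by linarith [hb.1], by linarith [hb.2]⟩) h3
  linarith

lemma cv_deriv (φ t : ℝ) : HasDerivAt (fun t => sin (t / 2) ^ 2 / sin (φ / 2) ^ 2)
    (sin (t / 2) * cos (t / 2) / sin (φ / 2) ^ 2) t := by
  have h : HasDerivAt (fun t : ℝ => t / 2) (1 / 2) t := (hasDerivAt_id t).div_const 2
  convert! (h.sin.pow 2).div_const (sin (φ / 2) ^ 2) using 1
  push_cast; ring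

lemma cv_point {lam φ t : ℝ} (hφ : φ ∈ Set.Ioo 0 π) (ht : t ∈ Set.Ioo 0 φ) (S : ℝ → ℝ) :
    |sin (t / 2) * cos (t / 2) / sin (φ / 2) ^ 2| •
      ((sin (t / 2) ^ 2 / sin (φ / 2) ^ 2) ^ ((1/2 : ℝ) - 1) *
        (1 - (sin (t / 2) ^ 2 / sin (φ / 2) ^ 2)) ^ (lam - 1) *
        S (sin (φ / 2) ^ 2 * (sin (t / 2) ^ 2 / sin (φ / 2) ^ 2))) =
    (sin (φ / 2) * (2 * sin (φ / 2) ^ 2) ^ (lam - 1))⁻¹ *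
      (cos (t / 2) * S (sin (t / 2) ^ 2) * (cos t - cos φ) ^ (lam - 1)) := by
  have h1 := hφ.1
  have h2 := hφ.2
  have hs : 0 < sin (φ / 2) := sin_pos_of_pos_of_lt_pi (by linarith) (by linarith)
  obtain ⟨h3, h4⟩ := sin_half_lt hφ ht
  have hc : 0 < cos (t / 2) := cos_pos_of_mem_Ioo ⟨by linarith [ht.1], by linarith [ht.2]⟩
  rw [cos_sub_cos_half]
  set s := sin (φ / 2)
  set x := sin (t / 2)
  set c := cos (t / 2)
  have hx : 0 < s ^ 2 - x ^ 2 := by nlinarith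
  rw [abs_of_pos (by positivity), mul_div_cancel₀ (x ^ 2) (by positivity : s ^ 2 ≠ 0)]
  have e1 : (x ^ 2 / s ^ 2) ^ ((1/2 : ℝ) - 1) = s / x := by
    rw [← div_pow, show ((1/2 : ℝ) - 1) = -(1/2) by norm_num, rpow_neg (by positivity),
      ← sqrt_eq_rpow, sqrt_sq (by positivity), inv_div]
  have e2 : (1 - x ^ 2 / s ^ 2) = (2 * (s ^ 2 - x ^ 2)) / (2 * s ^ 2) := by field_simp
  rw [e1, e2, div_rpow (by positivity) (by positivity)]
  have : 0 < (2 * s ^ 2) ^ (lam - 1) := by positivity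
  rw [smul_eq_mul]
  field_simp

open MeasureTheory in
lemma cv_integral {lam φ : ℝ} (hφ : φ ∈ Set.Ioo 0 π) (S : ℝ → ℝ) :
    ∫ t in Set.Ioo 0 φ, cos (t / 2) * S (sin (t / 2) ^ 2) * (cos t - cos φ) ^ (lam - 1) =
    (sin (φ / 2) * (2 * sin (φ / 2) ^ 2) ^ (lam - 1)) *
      ∫ y in Set.Ioo (0:ℝ) 1, y ^ ((1/2 : ℝ) - 1) * (1 - y) ^ (lam - 1) *
        S (sin (φ / 2) ^ 2 * y) := by
  have h1 := hφ.1
  have h2 := hφ.2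
  have hs : 0 < sin (φ / 2) := sin_pos_of_pos_of_lt_pi (by linarith) (by linarith)
  have h := integral_image_eq_integral_abs_deriv_smul (s := Set.Ioo 0 φ) measurableSet_Ioo
    (fun t _ => (cv_deriv φ t).hasDerivWithinAt) (cv_inj hφ)
    (fun y => y ^ ((1/2 : ℝ) - 1) * (1 - y) ^ (lam - 1) * S (sin (φ / 2) ^ 2 * y))
  rw [cv_image hφ, setIntegral_congr_fun measurableSet_Ioo
    (fun t ht => cv_point (lam := lam) hφ ht S), integral_const_mul] at h
  rw [h]
  have : 0 < (2 * sin (φ / 2) ^ 2) ^ (lam - 1) := by positivity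
  field_simp

open MeasureTheory in
lemma weight_integrable {lam φ : ℝ} (hlam : 0 < lam) (hφ : φ ∈ Set.Ioo 0 π) :
    IntegrableOn (fun t => (cos t - cos φ) ^ (lam - 1)) (Set.Ioo 0 φ) := by
  have h1 := hφ.1
  have h2 := hφ.2
  have hs : 0 < sin (φ / 2) := sin_pos_of_pos_of_lt_pi (by linarith) (by linarith)
  have hc : 0 < cos (φ / 2) := cos_pos_of_mem_Ioo ⟨by linarith, by linarith⟩
  have h := (integrableOn_image_iff_integrableOn_abs_deriv_smul (s := Set.Ioo 0 φ) measurableSet_Ioo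
    (fun t _ => (cv_deriv φ t).hasDerivWithinAt) (cv_inj hφ)
    (fun y => y ^ ((1/2 : ℝ) - 1) * (1 - y) ^ (lam - 1) * (fun _ => (1:ℝ)) (sin (φ / 2) ^ 2 * y))).1 (by
      rw [cv_image hφ]
      simpa only [mul_one] using (real_beta (by norm_num : (0:ℝ) < 1/2) hlam).1)
  have h' := h.congr_fun (fun t ht => cv_point (lam := lam) hφ ht (fun _ => 1)) measurableSet_Ioo
  have h'' := h'.const_mul ((sin (φ / 2) * (2 * sin (φ / 2) ^ 2) ^ (lam - 1)) * (1 / cos (φ / 2)))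
  refine Integrable.mono' h'' ?_ ?_
  · apply AEMeasurable.aestronglyMeasurable
    fun_prop
  · refine (ae_restrict_iff' measurableSet_Ioo).2 (Filter.Eventually.of_forall fun t ht => ?_)
    have hpos : 0 ≤ (cos t - cos φ) ^ (lam - 1) := by
      apply rpow_nonneg
      have := cos_lt_cos_of_nonneg_of_le_pi ht.1.le h2.le ht.2
      linarith
    have hcc : cos (φ / 2) ≤ cos (t / 2) :=
      cos_le_cos_of_nonneg_of_le_pi (by linarith [ht.1]) (by linarith) (by linarith [ht.2])
    have : 0 < (2 * sin (φ / 2) ^ 2) ^ (lam - 1) := by positivity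
    rw [norm_of_nonneg hpos]
    have e : sin (φ / 2) * (2 * sin (φ / 2) ^ 2) ^ (lam - 1) * (1 / cos (φ / 2)) *
        ((sin (φ / 2) * (2 * sin (φ / 2) ^ 2) ^ (lam - 1))⁻¹ *
      (cos (t / 2) * 1 * (cos t - cos φ) ^ (lam - 1))) =
       cos (t / 2) / cos (φ / 2) * (cos t - cos φ) ^ (lam - 1) := by field_simp
    simp only [e]
    have : 1 ≤ cos (t / 2) / cos (φ / 2) := by rwa [one_le_div hc]
    nlinarith

open MeasureTheory in
lemma series_integral (a b : ℝ) {lam x : ℝ} (hlam : 0 < lam) (hx0 : 0 ≤ x) (hx : x < 1) :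
    ∫ y in Set.Ioo (0:ℝ) 1, y ^ ((1/2 : ℝ) - 1) * (1 - y) ^ (lam - 1) *
        ev (hyp a b (1/2)) (x * y) =
    √π * Gamma lam / Gamma (lam + 1/2) * ev (hyp a b (lam + 1/2)) x := by
  have hhalf : (0:ℝ) < 1/2 := by norm_num
  set h : ℕ → ℝ := fun n => PowerSeries.coeff n (hyp a b (1/2)) with hh
  set F : ℕ → ℝ → ℝ := fun n y => h n * x ^ n * (y ^ ((1/2 + n : ℝ) - 1) * (1 - y) ^ (lam - 1)) with hF
  have hpt : ∀ y ∈ Set.Ioo (0:ℝ) 1, y ^ ((1/2 : ℝ) - 1) * (1 - y) ^ (lam - 1) *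
        ev (hyp a b (1/2)) (x * y) = ∑' n, F n y := by
    intro y hy
    rw [ev, ← tsum_mul_left]
    refine tsum_congr fun n => ?_
    simp only [hF, hh]
    rw [show (1/2 + n : ℝ) - 1 = (1/2 - 1) + (n : ℝ) by ring, rpow_add hy.1, rpow_natCast, mul_pow]
    ring
  rw [setIntegral_congr_fun measurableSet_Ioo hpt]
  have hb (n : ℕ) := real_beta (show (0:ℝ) < 1/2 + n by positivity) hlam
  have hFi (n : ℕ) : Integrable (F n) (volume.restrict (Set.Ioo 0 1)) := (hb n).1.const_mul _
  have hIntg (n : ℕ) : ∫ y in Set.Ioo (0:ℝ) 1, F n y =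
      h n * x ^ n * (Gamma (1/2 + n) * Gamma lam / Gamma (1/2 + n + lam)) := by
    simp only [hF]
    rw [integral_const_mul, (hb n).2]
  have hnn (n : ℕ) : ∀ y ∈ Set.Ioo (0:ℝ) 1, 0 ≤ y ^ ((1/2 + n : ℝ) - 1) * (1 - y) ^ (lam - 1) :=
    fun y hy => mul_nonneg (rpow_nonneg hy.1.le _) (rpow_nonneg (by linarith [hy.2]) _)
  have hle (n : ℕ) : ∫ y in Set.Ioo (0:ℝ) 1, y ^ ((1/2 + n : ℝ) - 1) * (1 - y) ^ (lam - 1) ≤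
      ∫ y in Set.Ioo (0:ℝ) 1, y ^ ((1/2 + (0:ℕ) : ℝ) - 1) * (1 - y) ^ (lam - 1) := by
    refine setIntegral_mono_on (hb n).1 (hb 0).1 measurableSet_Ioo fun y hy => ?_
    refine mul_le_mul_of_nonneg_right ?_ (rpow_nonneg (by linarith [hy.2]) _)
    refine rpow_le_rpow_of_exponent_ge hy.1 hy.2.le ?_
    have : (0:ℝ) ≤ n := by positivity
    push_cast; linarith
  have hsum : Summable fun n => ∫ y in Set.Ioo (0:ℝ) 1, ‖F n y‖ := by
    have hx' : |x| < 1 := by rwa [abs_of_nonneg hx0]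
    refine Summable.of_nonneg_of_le (fun n => integral_nonneg fun _ => norm_nonneg _) (fun n => ?_)
      ((conv_hyp a b hhalf x hx').mul_right
        (∫ y in Set.Ioo (0:ℝ) 1, y ^ ((1/2 + (0:ℕ) : ℝ) - 1) * (1 - y) ^ (lam - 1)))
    have e : ∫ y in Set.Ioo (0:ℝ) 1, ‖F n y‖ = ‖h n * x ^ n‖ *
        ∫ y in Set.Ioo (0:ℝ) 1, y ^ ((1/2 + n : ℝ) - 1) * (1 - y) ^ (lam - 1) := by
      rw [← integral_const_mul]
      refine setIntegral_congr_fun measurableSet_Ioo fun y hy => ?_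
      simp only [hF]
      rw [norm_mul, norm_of_nonneg (hnn n y hy)]
    rw [e]
    exact mul_le_mul_of_nonneg_left (hle n) (norm_nonneg _)
  rw [← (hasSum_integral_of_summable_integral_norm hFi hsum).tsum_eq, ev, ← tsum_mul_left]
  refine tsum_congr fun n => ?_
  rw [hIntg, show (1/2 + n + lam : ℝ) = (lam + 1/2) + n by ring, gamma_poch hhalf,
    gamma_poch (by positivity : 0 < lam + 1/2), Real.Gamma_one_half_eq]
  simp only [hh, hyp, PowerSeries.coeff_mk]
  have := poch_pos hhalf n
  have := poch_pos (by positivity : 0 < lam + 1/2) n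
  have := Gamma_pos_of_pos (by positivity : 0 < lam + 1/2)
  field_simp

/-- Mehler–Dirichlet type formula. -/
lemma mehler {lam nu φ : ℝ} (hlam : 0 < lam) (hN : 0 < nu + lam) (hφ : φ ∈ Set.Ioo 0 π) :
    ∫ t in Set.Ioo 0 φ, cos ((nu + lam) * t) * (cos t - cos φ) ^ (lam - 1) =
      √π * Gamma lam / (2 ^ lam * Gamma (lam + 1/2)) * sin φ ^ (2 * lam - 1) * rG lam nu (cos φ) := by
  have h1 := hφ.1
  have h2 := hφ.2
  have hs : 0 < sin (φ / 2) := sin_pos_of_pos_of_lt_pi (by linarith) (by linarith)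
  have hc : 0 < cos (φ / 2) := cos_pos_of_mem_Ioo ⟨by linarith, by linarith⟩
  have hsq := sin_sq_add_cos_sq (φ / 2)
  set N := nu + lam with hNdef
  have e1 : ∫ t in Set.Ioo 0 φ, cos (N * t) * (cos t - cos φ) ^ (lam - 1) =
      ∫ t in Set.Ioo 0 φ, cos (t / 2) * ev (hyp (1/2 + N) (1/2 - N) (1/2)) (sin (t / 2) ^ 2) *
        (cos t - cos φ) ^ (lam - 1) := by
    refine MeasureTheory.setIntegral_congr_fun measurableSet_Ioo fun t ht => ?_
    rw [cos_expand hN.ne' ⟨by linarith [ht.1], by linarith [ht.2]⟩]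
  have hx1 : sin (φ / 2) ^ 2 < 1 := by nlinarith
  rw [e1, cv_integral hφ, series_integral _ _ hlam (sq_nonneg _) hx1,
    euler _ _ (by positivity : 0 < lam + 1/2) (by rwa [abs_of_nonneg (sq_nonneg _)])]
  have e2 : rG lam nu (cos φ) = ev (hyp (lam + 1/2 - (1/2 + N)) (lam + 1/2 - (1/2 - N)) (lam + 1/2))
      (sin (φ / 2) ^ 2) := by
    have a1 : lam + 1/2 - (1/2 + N) = -nu := by rw [hNdef]; ring
    have a2 : lam + 1/2 - (1/2 - N) = nu + 2 * lam := by rw [hNdef]; ring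
    have a3 : (1 - cos φ) / 2 = sin (φ / 2) ^ 2 := by
      have := cos_eq_half φ
      linarith
    rw [a1, a2, rG, ev, a3]
    simp only [hyp, PowerSeries.coeff_mk]
  rw [e2]
  generalize ev _ _ = G
  have e3 : sin φ = 2 * sin (φ / 2) * cos (φ / 2) := by rw [← sin_two_mul]; congr 1; ring
  have e4 : 1 - sin (φ / 2) ^ 2 = cos (φ / 2) ^ 2 := by linarith
  rw [e3, e4]
  generalize sin (φ / 2) = s at *
  generalize cos (φ / 2) = c at *
  rw [mul_rpow (by positivity) (by positivity), mul_rpow (by positivity) (by positivity),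
    mul_rpow (by positivity) (by positivity), ← rpow_natCast_mul hs.le, ← rpow_natCast_mul hc.le]
  have e5 : s * s ^ (((2:ℕ):ℝ) * (lam - 1)) = s ^ (2 * lam - 1) := by
    nth_rw 1 [← rpow_one s]
    rw [← rpow_add hs]; congr 1; push_cast; ring
  have e6 : c ^ (((2:ℕ):ℝ) * (lam + 1/2 - (1/2 + N) - (1/2 - N))) = c ^ (2 * lam - 1) := by
    congr 1; push_cast; ring
  have e7 : (2:ℝ) ^ (2 * lam - 1) = 2 ^ (lam - 1) * 2 ^ lam := by
    rw [← rpow_add two_pos]; congr 1; ring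
  rw [e6, e7, ← e5]
  have := Gamma_pos_of_pos (by positivity : 0 < lam + 1/2)
  have : (0:ℝ) < 2 ^ lam := by positivity
  field_simp

/-- the integrand of the contour integral -/
noncomputable def cf (N p φ : ℝ) (z : ℂ) : ℂ :=
  Complex.exp (Complex.I * N * z) * (Complex.cos z - Complex.cos φ) ^ (p : ℂ)

lemma cw_eq (φ t s : ℝ) : Complex.cos (t + s * Complex.I) - Complex.cos φ =
    ((cos t * cosh s - cos φ : ℝ) : ℂ) + ((-(sin t * sinh s) : ℝ) : ℂ) * Complex.I := by
  rw [Complex.cos_add_mul_I]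
  push_cast
  ring

lemma cw_re (φ t s : ℝ) : (Complex.cos (t + s * Complex.I) - Complex.cos φ).re =
    cos t * cosh s - cos φ := by
  rw [cw_eq]; simp [-Complex.ofReal_neg, -Complex.ofReal_mul, -Complex.ofReal_sub]

lemma cw_im (φ t s : ℝ) : (Complex.cos (t + s * Complex.I) - Complex.cos φ).im =
    -(sin t * sinh s) := by
  rw [cw_eq]; simp [-Complex.ofReal_neg, -Complex.ofReal_mul, -Complex.ofReal_sub]

lemma cw_slit {φ t s : ℝ} (hφ : φ ∈ Set.Ioo 0 π) (ht : t ∈ Set.Icc 0 φ) (hs : 0 < s) :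
    Complex.cos (t + s * Complex.I) - Complex.cos φ ∈ Complex.slitPlane := by
  rw [Complex.mem_slitPlane_iff, cw_re, cw_im]
  rcases ht.1.eq_or_lt with h | h
  · left
    rw [← h, cos_zero]
    have h1 := one_lt_cosh.2 hs.ne'
    have h2 := cos_le_one φ
    linarith
  · right
    have h1 : 0 < sin t := sin_pos_of_pos_of_lt_pi h (ht.2.trans_lt hφ.2)
    have h2 := sinh_pos_iff.2 hs
    have : 0 < sin t * sinh s := by positivity
    linarith

lemma cw_slit0 {φ t : ℝ} (hφ : φ ∈ Set.Ioo 0 π) (ht : t ∈ Set.Ioo 0 φ) :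
    Complex.cos t - Complex.cos φ ∈ Complex.slitPlane := by
  rw [Complex.mem_slitPlane_iff]
  left
  have := cos_lt_cos_of_nonneg_of_le_pi ht.1.le hφ.2.le ht.2
  have e : Complex.cos t - Complex.cos φ = ((cos t - cos φ : ℝ) : ℂ) := by push_cast; rfl
  rw [e, Complex.ofReal_re]
  linarith

lemma cw_normsq (φ t s : ℝ) : ‖Complex.cos (t + s * Complex.I) - Complex.cos φ‖ ^ 2 =
    cos t ^ 2 + cos φ ^ 2 - 2 * (cos t * cos φ) * cosh s + (cosh s ^ 2 - 1) := by
  rw [← Complex.normSq_eq_norm_sq, Complex.normSq_apply, cw_re, cw_im]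
  have h1 := sin_sq_add_cos_sq t
  have h2 := cosh_sq s
  have h3 : sin t ^ 2 = 1 - cos t ^ 2 := by linarith
  have h4 : sinh s ^ 2 = cosh s ^ 2 - 1 := by linarith
  have : -(sin t * sinh s) * -(sin t * sinh s) = (1 - cos t ^ 2) * (cosh s ^ 2 - 1) := by
    rw [← h3, ← h4]; ring
  rw [this]; ring

lemma cos_mul_cos_le (t φ : ℝ) : |cos t * cos φ| ≤ 1 := by
  rw [abs_mul]
  exact mul_le_one₀ (abs_cos_le_one _) (abs_nonneg _) (abs_cos_le_one _)

lemma cw_lower (φ t s : ℝ) : cos t - cos φ ≤ ‖Complex.cos (t + s * Complex.I) - Complex.cos φ‖ := by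
  apply le_of_sq_le_sq _ (norm_nonneg _)
  rw [cw_normsq]
  have h1 := one_le_cosh s
  have h2 := abs_le.1 (cos_mul_cos_le t φ)
  nlinarith [mul_nonneg (sub_nonneg.2 h1) (show 0 ≤ cosh s + 1 - 2 * (cos t * cos φ) by linarith)]

lemma cw_lower2 (φ t s : ℝ) : cosh s - 1 ≤ ‖Complex.cos (t + s * Complex.I) - Complex.cos φ‖ := by
  apply le_of_sq_le_sq _ (norm_nonneg _)
  rw [cw_normsq]
  have h1 := one_le_cosh s
  have h2 := abs_le.1 (cos_mul_cos_le t φ)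
  nlinarith [mul_nonneg (sub_nonneg.2 h1) (show 0 ≤ 1 - (cos t * cos φ) by linarith),
    sq_nonneg (cos t - cos φ)]

lemma cw_upper (φ t s : ℝ) : ‖Complex.cos (t + s * Complex.I) - Complex.cos φ‖ ≤ cosh s + 1 := by
  have h1 := one_le_cosh s
  apply le_of_sq_le_sq _ (by linarith)
  rw [cw_normsq]
  have h2 := abs_le.1 (cos_mul_cos_le t φ)
  nlinarith [mul_nonneg (by linarith : 0 ≤ cosh s) (show 0 ≤ 1 + (cos t * cos φ) by linarith),
    cos_sq_le_one t, cos_sq_le_one φ]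

lemma cf_norm (N p φ t s : ℝ) : ‖cf N p φ (t + s * Complex.I)‖ =
    exp (-(N * s)) * ‖Complex.cos (t + s * Complex.I) - Complex.cos φ‖ ^ p := by
  rw [cf, norm_mul, Complex.norm_cpow_real, Complex.norm_exp]
  congr 2
  simp

lemma cf_diffAt {N p φ : ℝ} {z : ℂ} (h : Complex.cos z - Complex.cos φ ∈ Complex.slitPlane) :
    DifferentiableAt ℂ (cf N p φ) z := by
  unfold cf
  refine DifferentiableAt.mul (by fun_prop) ?_
  exact DifferentiableAt.cpow (by fun_prop) (by fun_prop) h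

lemma cf_rect {N p φ ε R : ℝ} (hφ : φ ∈ Set.Ioo 0 π) (hε : 0 < ε) (hR : ε ≤ R) :
    (∫ x : ℝ in (0:ℝ)..φ, cf N p φ (x + ε * Complex.I)).re -
      (∫ x : ℝ in (0:ℝ)..φ, cf N p φ (x + R * Complex.I)).re =
      (∫ y : ℝ in ε..R, cf N p φ (φ + y * Complex.I)).im := by
  have h := Complex.integral_boundary_rect_eq_zero_of_differentiableOn (cf N p φ)
    (⟨0, ε⟩ : ℂ) (⟨φ, R⟩ : ℂ) (by
      intro z hz
      rw [Complex.mem_reProdIm] at hz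
      simp only [Set.uIcc_of_le hφ.1.le, Set.uIcc_of_le hR] at hz
      have := cw_slit hφ hz.1 (hε.trans_le hz.2.1)
      rw [Complex.re_add_im] at this
      exact (cf_diffAt this).differentiableWithinAt)
  simp only at h
  have hleft : ∀ y ∈ Set.uIcc ε R, cf N p φ (((0:ℝ):ℂ) + y * Complex.I) =
      ((exp (-(N * y)) * (cosh y - cos φ) ^ p : ℝ) : ℂ) := by
    intro y hy
    have e := cw_eq φ 0 y
    simp only [sin_zero, cos_zero, one_mul, zero_mul, neg_zero, Complex.ofReal_zero, add_zero] at e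
    have h0 : 0 ≤ cosh y - cos φ := by linarith [one_le_cosh y, cos_le_one φ]
    rw [cf, Complex.ofReal_zero, e, Complex.ofReal_mul, Complex.ofReal_cpow h0, Complex.ofReal_exp]
    congr 2
    push_cast
    linear_combination (N * y : ℂ) * Complex.I_mul_I
  rw [intervalIntegral.integral_congr hleft, intervalIntegral.integral_ofReal] at h
  have h2 := congrArg Complex.re h
  simp only [smul_eq_mul, Complex.sub_re, Complex.add_re, Complex.I_mul_re, Complex.ofReal_im,
    Complex.zero_re, neg_zero, sub_zero] at h2
  linarith

open MeasureTheory Filter Topology in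
lemma cf_bottom {N p φ : ℝ} (hN : 0 < N) (hp : -1 < p) (hφ : φ ∈ Set.Ioo 0 π) (ε : ℕ → ℝ)
    (hε : ∀ n, 0 < ε n) (hε1 : ∀ n, ε n ≤ 1) (hlim : Tendsto ε atTop (𝓝 0)) :
    Tendsto (fun n => ∫ x : ℝ in (0:ℝ)..φ, cf N p φ (x + ε n * Complex.I)) atTop
      (𝓝 (∫ x : ℝ in Set.Ioo 0 φ, cf N p φ x)) := by
  simp only [intervalIntegral.integral_of_le hφ.1.le, integral_Ioc_eq_integral_Ioo]
  have hw := weight_integrable (lam := p + 1) (by linarith) hφ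
  rw [add_sub_cancel_right] at hw
  have hcont : ∀ n, ContinuousOn (fun x : ℝ => cf N p φ (x + ε n * Complex.I)) (Set.Ioo 0 φ) := by
    intro n x hx
    have h1 := (cf_diffAt (N := N) (p := p) (cw_slit hφ ⟨hx.1.le, hx.2.le⟩ (hε n))).continuousAt
    have h2 : ContinuousAt (fun x : ℝ => (x : ℂ) + ε n * Complex.I) x := by fun_prop
    exact (ContinuousAt.comp (f := fun x : ℝ => (x : ℂ) + ε n * Complex.I) h1 h2).continuousWithinAt
  refine tendsto_integral_of_dominated_convergence
    (fun t => (cos t - cos φ) ^ p + (cosh 1 + 1) ^ p)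
    (fun n => (hcont n).aestronglyMeasurable measurableSet_Ioo)
    (hw.add (integrable_const _)) (fun n => ?_) ?_
  · refine (ae_restrict_iff' measurableSet_Ioo).2 (Eventually.of_forall fun t ht => ?_)
    rw [cf_norm]
    have hpos : 0 < cos t - cos φ := by
      have := cos_lt_cos_of_nonneg_of_le_pi ht.1.le hφ.2.le ht.2
      linarith
    have hA : 0 ≤ (cos t - cos φ) ^ p := rpow_nonneg hpos.le _
    have hc1 := one_le_cosh (1:ℝ)
    have hB : 0 ≤ (cosh 1 + 1) ^ p := rpow_nonneg (by linarith) _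
    have hE : exp (-(N * ε n)) ≤ 1 := exp_le_one_iff.2 (by nlinarith [hε n])
    have hW : ‖Complex.cos (t + ε n * Complex.I) - Complex.cos φ‖ ^ p ≤
        (cos t - cos φ) ^ p + (cosh 1 + 1) ^ p := by
      rcases le_total p 0 with h | h
      · have := rpow_le_rpow_of_nonpos hpos (cw_lower φ t (ε n)) h
        linarith
      · have hch : cosh (ε n) ≤ cosh 1 := by
          rw [cosh_le_cosh, abs_of_pos (hε n), abs_one]; exact hε1 n
        have := rpow_le_rpow (norm_nonneg _) ((cw_upper φ t (ε n)).trans (by linarith : _ ≤ cosh 1 + 1)) h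
        linarith
    calc _ ≤ 1 * ‖Complex.cos (t + ε n * Complex.I) - Complex.cos φ‖ ^ p :=
          mul_le_mul_of_nonneg_right hE (rpow_nonneg (norm_nonneg _) _)
      _ ≤ _ := by rw [one_mul]; exact hW
  · refine (ae_restrict_iff' measurableSet_Ioo).2 (Eventually.of_forall fun t ht => ?_)
    have h1 := (cf_diffAt (N := N) (p := p) (cw_slit0 hφ ht)).continuousAt
    refine Tendsto.comp h1 ?_
    have h2 : Tendsto (fun n => (t : ℂ) + (ε n : ℂ) * Complex.I) atTop
        (𝓝 ((t : ℂ) + ((0:ℝ) : ℂ) * Complex.I)) :=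
      (((Complex.continuous_ofReal.tendsto 0).comp hlim).mul_const _).const_add _
    simpa using h2

lemma cosh_le_exp' {s : ℝ} (hs : 0 ≤ s) : cosh s ≤ exp s := by
  have h := cosh_add_sinh s
  have := sinh_nonneg_iff.2 hs
  linarith

open MeasureTheory Filter Topology in
lemma cf_top {N p φ : ℝ} (hN : 1 < N) (hp1 : p ≤ 1) (hφ : φ ∈ Set.Ioo 0 π) (R : ℕ → ℝ)
    (hR : ∀ n, 2 ≤ R n) (hlim : Tendsto R atTop atTop) :
    Tendsto (fun n => ∫ x : ℝ in (0:ℝ)..φ, cf N p φ (x + R n * Complex.I)) atTop (𝓝 0) := by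
  have hb : ∀ n, ‖∫ x : ℝ in (0:ℝ)..φ, cf N p φ (x + R n * Complex.I)‖ ≤
      2 * exp (-((N - 1) * R n)) * |φ - 0| := by
    intro n
    refine intervalIntegral.norm_integral_le_of_norm_le_const fun t _ => ?_
    rw [cf_norm]
    have h1 := cw_lower2 φ t (R n)
    have h2 := cw_upper φ t (R n)
    have h3 := cosh_le_exp' (by linarith [hR n] : 0 ≤ R n)
    have h4 : 2 ≤ cosh (R n) := by
      have h5 := add_one_le_exp (R n)
      have h6 := exp_pos (-(R n))
      have h8 := quadratic_le_exp_of_nonneg (by linarith [hR n] : 0 ≤ R n)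
      rw [cosh_eq]; nlinarith [hR n]
    set w := ‖Complex.cos (t + R n * Complex.I) - Complex.cos φ‖
    have h5 : w ^ p ≤ 2 * exp (R n) := by
      calc w ^ p ≤ w ^ (1:ℝ) := rpow_le_rpow_of_exponent_le (by linarith) hp1
        _ = w := rpow_one w
        _ ≤ _ := by linarith
    calc exp (-(N * R n)) * w ^ p ≤ exp (-(N * R n)) * (2 * exp (R n)) := by gcongr
      _ = 2 * (exp (-(N * R n)) * exp (R n)) := by ring
      _ = 2 * exp (-((N - 1) * R n)) := by rw [← exp_add]; ring_nf
  refine squeeze_zero_norm hb ?_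
  have h1 : Tendsto (fun n => -((N - 1) * R n)) atTop atBot :=
    tendsto_neg_atTop_atBot.comp (hlim.const_mul_atTop (by linarith))
  have h2 := ((tendsto_exp_atBot.comp h1).const_mul 2).mul_const |φ - 0|
  simpa using h2

open MeasureTheory Filter Topology in
lemma contour {N p φ : ℝ} (hN : 1 < N) (hp : -1 < p) (hp1 : p ≤ 1) (hφ : φ ∈ Set.Ioo 0 π)
    (hIntg : IntegrableOn (fun y : ℝ => cf N p φ (φ + y * Complex.I)) (Set.Ioi 0)) :
    ∫ t in Set.Ioo 0 φ, cos (N * t) * (cos t - cos φ) ^ p =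
      (∫ y : ℝ in Set.Ioi (0:ℝ), cf N p φ (φ + y * Complex.I)).im := by
  set ε : ℕ → ℝ := fun n => 1 / ((n : ℝ) + 1) with hεd
  set R : ℕ → ℝ := fun n => (n : ℝ) + 2 with hRd
  have hε : ∀ n, 0 < ε n := fun n => by positivity
  have hε1 : ∀ n, ε n ≤ 1 := fun n => by
    simp only [hεd]; rw [div_le_one (by positivity)]
    have : (0:ℝ) ≤ n := by positivity
    linarith
  have hεl : Tendsto ε atTop (𝓝 0) := tendsto_one_div_add_atTop_nhds_zero_nat
  have hR : ∀ n, 2 ≤ R n := fun n => by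
    have : (0:ℝ) ≤ n := by positivity
    simp only [hRd]; linarith
  have hRl : Tendsto R atTop atTop := tendsto_atTop_add_const_right _ _ tendsto_natCast_atTop_atTop
  have hle : ∀ n, ε n ≤ R n := fun n => by linarith [hε1 n, hR n]
  have h1 := cf_bottom (N := N) (by linarith) hp hφ ε hε hε1 hεl
  have h2 := cf_top hN hp1 hφ R hR hRl
  have h3 := ((Complex.continuous_re.tendsto _).comp h1).sub ((Complex.continuous_re.tendsto _).comp h2)
  have h4 : Tendsto (fun n => (∫ y : ℝ in ε n..R n, cf N p φ (φ + y * Complex.I)).im) atTop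
      (𝓝 ((∫ x : ℝ in Set.Ioo 0 φ, cf N p φ x).re - (0:ℂ).re)) :=
    h3.congr fun n => cf_rect hφ (hε n) (hle n)
  have hcov : AECover (volume.restrict (Set.Ioi (0:ℝ))) atTop (fun n => Set.Ioc (ε n) (R n)) := by
    refine ⟨?_, fun n => measurableSet_Ioc⟩
    refine (ae_restrict_iff' measurableSet_Ioi).2 (Eventually.of_forall fun s hs => ?_)
    filter_upwards [hεl.eventually (gt_mem_nhds (show (0:ℝ) < s from hs)),
      hRl.eventually_ge_atTop s] with n ha hb
    exact ⟨ha, hb⟩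
  have h5 := hcov.integral_tendsto_of_countably_generated hIntg
  have h6 : Tendsto (fun n => ∫ y : ℝ in ε n..R n, cf N p φ (φ + y * Complex.I)) atTop
      (𝓝 (∫ y : ℝ in Set.Ioi (0:ℝ), cf N p φ (φ + y * Complex.I))) := by
    refine h5.congr fun n => ?_
    have hsub : Set.Ioc (ε n) (R n) ⊆ Set.Ioi 0 := fun x hx => (hε n).trans hx.1
    rw [intervalIntegral.integral_of_le (hle n), Measure.restrict_restrict measurableSet_Ioc,
      Set.inter_eq_left.2 hsub]
  have h7 := tendsto_nhds_unique h4 ((Complex.continuous_im.tendsto _).comp h6)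
  rw [← h7, Complex.zero_re, sub_zero]
  have hw := weight_integrable (lam := p + 1) (by linarith) hφ
  rw [add_sub_cancel_right] at hw
  have e : ∀ t ∈ Set.Ioo 0 φ, cf N p φ t =
      Complex.exp (Complex.I * N * t) * (((cos t - cos φ) ^ p : ℝ) : ℂ) := by
    intro t ht
    have := cos_lt_cos_of_nonneg_of_le_pi ht.1.le hφ.2.le ht.2
    rw [cf, Complex.ofReal_cpow (by linarith)]; push_cast; rfl
  have hci : IntegrableOn (fun t : ℝ => Complex.exp (Complex.I * N * t) *
      (((cos t - cos φ) ^ p : ℝ) : ℂ)) (Set.Ioo 0 φ) := by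
    refine Integrable.bdd_mul (c := 1) hw.ofReal ?_ ?_
    · apply Continuous.aestronglyMeasurable; fun_prop
    · refine Eventually.of_forall fun t => ?_
      rw [Complex.norm_exp]; simp
  rw [setIntegral_congr_fun measurableSet_Ioo e]
  have h8 := integral_re hci
  simp only [RCLike.re_to_complex] at h8
  rw [← h8]
  refine setIntegral_congr_fun measurableSet_Ioo fun t _ => ?_
  rw [Complex.re_mul_ofReal, show Complex.I * N * t = ((N * t : ℝ) : ℂ) * Complex.I by push_cast; ring,
    Complex.exp_ofReal_mul_I_re]

lemma sinh_le_mul_cosh {s : ℝ} (hs : 0 ≤ s) : sinh s ≤ s * cosh s := by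
  have hm : MonotoneOn (fun s => s * cosh s - sinh s) (Set.Ici 0) := by
    apply monotoneOn_of_deriv_nonneg (convex_Ici 0)
    · fun_prop
    · fun_prop
    · intro x hx
      rw [interior_Ici] at hx
      have : HasDerivAt (fun s => s * cosh s - sinh s) (1 * cosh x + x * sinh x - cosh x) x :=
        ((hasDerivAt_id' x).mul (hasDerivAt_cosh x)).sub (hasDerivAt_sinh x)
      rw [this.deriv]
      have := mul_nonneg (le_of_lt hx) (sinh_nonneg_iff.2 (le_of_lt hx))
      linarith
  have := hm (Set.self_mem_Ici) hs hs
  simp at this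
  linarith

lemma cosh_sub_one_le {s : ℝ} (hs : 0 ≤ s) : cosh s - 1 ≤ s / 2 * sinh s := by
  have h := sinh_le_mul_cosh (show 0 ≤ s / 2 by linarith)
  have h0 := sinh_nonneg_iff.2 (show 0 ≤ s / 2 by linarith)
  have e1 : cosh s = cosh (s/2) ^ 2 + sinh (s/2) ^ 2 := by rw [← cosh_two_mul]; ring_nf
  have e2 : sinh s = 2 * sinh (s/2) * cosh (s/2) := by rw [← sinh_two_mul]; ring_nf
  have e3 := cosh_sq (s/2)
  rw [e1, e2, e3]
  nlinarith

lemma sinh_sub_le {s : ℝ} (hs : 0 ≤ s) : sinh s - s ≤ s ^ 3 / 6 * cosh s := by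
  have hm : MonotoneOn (fun s => s ^ 3 / 6 * cosh s - (sinh s - s)) (Set.Ici 0) := by
    apply monotoneOn_of_deriv_nonneg (convex_Ici 0)
    · fun_prop
    · fun_prop
    · intro x hx
      rw [interior_Ici] at hx
      have hx0 : 0 ≤ x := le_of_lt hx
      have : HasDerivAt (fun s => s ^ 3 / 6 * cosh s - (sinh s - s))
          (((3:ℕ) * x ^ 2 / 6) * cosh x + x ^ 3 / 6 * sinh x - (cosh x - 1)) x := by
        have := (((hasDerivAt_pow 3 x).div_const 6).mul (hasDerivAt_cosh x)).sub
          ((hasDerivAt_sinh x).sub (hasDerivAt_id' x))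
        exact this
      rw [this.deriv]
      have h1 := cosh_sub_one_le hx0
      have h2 := mul_le_mul_of_nonneg_left (sinh_le_mul_cosh hx0) (show 0 ≤ x / 2 by linarith)
      have h3 := mul_nonneg (show 0 ≤ x ^ 3 / 6 by positivity) (sinh_nonneg_iff.2 hx0)
      push_cast
      nlinarith
  have := hm (Set.self_mem_Ici) hs hs
  simp at this
  linarith

lemma cosh_le_exp2 {s : ℝ} (hs : 0 ≤ s) : cosh s ≤ exp s := by
  rw [cosh_eq]
  have : exp (-s) ≤ exp s := exp_le_exp.2 (by linarith)
  linarith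

lemma abs_rpow_sub_one {x p : ℝ} (hx : 1 ≤ x) (hp : -1 ≤ p) (hp1 : p ≤ 1) :
    |x ^ p - 1| ≤ |p| * (x - 1) := by
  have key : ∀ q : ℝ, 0 ≤ q → q ≤ 1 → x ^ q - 1 ≤ q * (x - 1) := by
    intro q h0 h1
    have := rpow_one_add_le_one_add_mul_self (s := x - 1) (by linarith) h0 h1
    rw [add_sub_cancel] at this
    linarith
  rcases le_total 0 p with h | h
  · rw [abs_of_nonneg h, abs_of_nonneg]
    · exact key p h hp1
    · linarith [one_le_rpow hx h]
  · have h1 := key (-p) (by linarith) (by linarith)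
    have h2 : x ^ p ≤ 1 := rpow_le_one_of_one_le_of_nonpos hx h
    have h3 : x ^ p * x ^ (-p) = 1 := by rw [← rpow_add (by linarith)]; simp
    have h4 : 1 ≤ x ^ (-p) := one_le_rpow hx (by linarith)
    rw [abs_of_nonpos h, abs_of_nonpos (by linarith)]
    nlinarith

lemma one_add_ne (y : ℝ) : 1 + (y : ℂ) * Complex.I ∈ Complex.slitPlane := by
  rw [Complex.mem_slitPlane_iff]; left; simp

lemma norm_one_add (y : ℝ) : 1 ≤ ‖1 + (y : ℂ) * Complex.I‖ := by
  have := Complex.abs_re_le_norm (1 + (y : ℂ) * Complex.I)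
  simpa using this

lemma norm_cpow_sub_one {p : ℝ} (hp1 : p ≤ 1) (y : ℝ) :
    ‖(1 + (y : ℂ) * Complex.I) ^ (p : ℂ) - 1‖ ≤ |p| * |y| := by
  have hd : ∀ t : ℝ, HasDerivAt (fun t : ℝ => (1 + (t : ℂ) * Complex.I) ^ (p : ℂ))
      ((p : ℂ) * (1 + (t : ℂ) * Complex.I) ^ ((p : ℂ) - 1) * Complex.I) t := by
    intro t
    have h1 : HasDerivAt (fun t : ℝ => 1 + (t : ℂ) * Complex.I) Complex.I t := by
      have := ((Complex.ofRealCLM.hasDerivAt (x := t)).mul_const Complex.I).const_add 1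
      simpa using this
    have h2 : HasDerivAt (fun z : ℂ => z ^ (p : ℂ))
        ((p : ℂ) * (1 + (t : ℂ) * Complex.I) ^ ((p : ℂ) - 1) * 1) (1 + (t : ℂ) * Complex.I) :=
      (hasDerivAt_id' _).cpow_const (one_add_ne t)
    rw [mul_one] at h2
    exact h2.comp t h1
  have hb : ∀ t ∈ (Set.univ : Set ℝ), ‖(p : ℂ) * (1 + (t : ℂ) * Complex.I) ^ ((p : ℂ) - 1) * Complex.I‖ ≤ |p| := by
    intro t _
    rw [norm_mul, norm_mul, Complex.norm_I, mul_one, Complex.norm_real, Real.norm_eq_abs]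
    have : (p : ℂ) - 1 = ((p - 1 : ℝ) : ℂ) := by push_cast; rfl
    rw [this, Complex.norm_cpow_real]
    have := rpow_le_one_of_one_le_of_nonpos (norm_one_add t) (show p - 1 ≤ 0 by linarith)
    exact mul_le_of_le_one_right (abs_nonneg p) this
  have := convex_univ.norm_image_sub_le_of_norm_hasDerivWithin_le
    (fun t _ => (hd t).hasDerivWithinAt) hb (Set.mem_univ 0) (Set.mem_univ y)
  simpa using this

lemma mul_cpow_arg {x y : ℂ} (hx : x ≠ 0) (hy : y ≠ 0) (h : x.arg + y.arg ∈ Set.Ioc (-π) π)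
    (c : ℂ) : (x * y) ^ c = x ^ c * y ^ c := by
  rw [Complex.cpow_def_of_ne_zero hx, Complex.cpow_def_of_ne_zero hy,
    Complex.cpow_def_of_ne_zero (mul_ne_zero hx hy), Complex.log_mul hx hy h, add_mul,
    Complex.exp_add]

lemma cf_factor {N p φ s : ℝ} (hφ : φ ∈ Set.Ioo 0 π) (hs : 0 < s) :
    cf N p φ (φ + s * Complex.I) = ((sin φ ^ p : ℝ) : ℂ) *
      Complex.exp (((N * φ - p * π / 2 : ℝ) : ℂ) * Complex.I) *
      (((exp (-(N * s)) * sinh s ^ p : ℝ) : ℂ) *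
        (1 + ((cos φ * (cosh s - 1) / (sin φ * sinh s) : ℝ) : ℂ) * Complex.I) ^ (p : ℂ)) := by
  have hsin : 0 < sin φ := sin_pos_of_pos_of_lt_pi hφ.1 hφ.2
  have hsh : 0 < sinh s := sinh_pos_iff.2 hs
  set y := cos φ * (cosh s - 1) / (sin φ * sinh s) with hy
  have hyy : sin φ * sinh s * y = cos φ * (cosh s - 1) := by rw [hy]; field_simp
  have e1 : Complex.cos (φ + s * Complex.I) - Complex.cos φ =
      ((sin φ * sinh s : ℝ) : ℂ) * (-Complex.I * (1 + (y : ℂ) * Complex.I)) := by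
    have : ((sin φ * sinh s : ℝ) : ℂ) * (-Complex.I * (1 + (y : ℂ) * Complex.I)) =
      ((sin φ * sinh s * y : ℝ) : ℂ) + ((-(sin φ * sinh s) : ℝ) : ℂ) * Complex.I := by
      push_cast
      linear_combination (-(Complex.sin φ * Complex.sinh s * y)) * Complex.I_sq
    rw [this, cw_eq, hyy]
    push_cast; ring
  have hz := Complex.slitPlane_ne_zero (one_add_ne y)
  have harg : |Complex.arg (1 + (y : ℂ) * Complex.I)| < π / 2 := by
    rw [Complex.abs_arg_lt_pi_div_two_iff]; left; simp
  rw [abs_lt] at harg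
  have e2 : (-Complex.I * (1 + (y : ℂ) * Complex.I)) ^ (p : ℂ) =
      Complex.exp (((- p * π / 2 : ℝ) : ℂ) * Complex.I) * (1 + (y : ℂ) * Complex.I) ^ (p : ℂ) := by
    have hI : -Complex.I ≠ 0 := by simp
    rw [mul_cpow_arg hI hz]
    · congr 1
      rw [Complex.cpow_def_of_ne_zero hI, Complex.log_neg_I]
      congr 1; push_cast; ring
    · rw [Complex.arg_neg_I]
      constructor <;> linarith [pi_pos]
  have hss : 0 < sin φ * sinh s := by positivity
  have e3 : (((sin φ * sinh s : ℝ) : ℂ) * (-Complex.I * (1 + (y : ℂ) * Complex.I))) ^ (p : ℂ) =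
      ((sin φ ^ p * sinh s ^ p : ℝ) : ℂ) * (-Complex.I * (1 + (y : ℂ) * Complex.I)) ^ (p : ℂ) := by
    rw [mul_cpow_arg (by exact_mod_cast hss.ne') (mul_ne_zero (by simp) hz),
      ← Complex.ofReal_cpow hss.le, mul_rpow hsin.le hsh.le]
    rw [Complex.arg_ofReal_of_nonneg hss.le, zero_add]
    exact Complex.arg_mem_Ioc _
  rw [cf, e1, e3, e2]
  have e4 : Complex.exp (Complex.I * N * (φ + s * Complex.I)) =
      ((exp (-(N * s)) : ℝ) : ℂ) * Complex.exp (((N * φ : ℝ) : ℂ) * Complex.I) := by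
    rw [Complex.ofReal_exp, ← Complex.exp_add]
    congr 1
    push_cast
    linear_combination (N * s : ℂ) * Complex.I_sq
  have e5 : Complex.exp (((N * φ - p * π / 2 : ℝ) : ℂ) * Complex.I) =
      Complex.exp (((N * φ : ℝ) : ℂ) * Complex.I) *
        Complex.exp (((- p * π / 2 : ℝ) : ℂ) * Complex.I) := by
    rw [← Complex.exp_add]
    congr 1
    push_cast; ring
  rw [e4, e5]
  simp only [Complex.ofReal_mul]
  ring

/-- pointwise estimate of the remainder -/
lemma rem_bound {N p φ s : ℝ} (hp : -1 < p) (hp1 : p ≤ 1) (hφ : φ ∈ Set.Ioo 0 π) (hs : 0 < s) :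
    ‖((exp (-(N * s)) * sinh s ^ p : ℝ) : ℂ) *
        (1 + ((cos φ * (cosh s - 1) / (sin φ * sinh s) : ℝ) : ℂ) * Complex.I) ^ (p : ℂ) -
        ((s ^ p * exp (-(N * s)) : ℝ) : ℂ)‖ ≤
      |p| / (2 * sin φ) * (s ^ (p + 2 - 1) * exp (-((N - 1) * s))) +
        |p| / 6 * (s ^ (p + 3 - 1) * exp (-((N - 1) * s))) := by
  have hsin : 0 < sin φ := sin_pos_of_pos_of_lt_pi hφ.1 hφ.2
  have hsh : 0 < sinh s := sinh_pos_iff.2 hs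
  set y := cos φ * (cosh s - 1) / (sin φ * sinh s) with hy
  have hyb : |y| ≤ s / (2 * sin φ) := by
    rw [hy, abs_div, abs_mul, abs_of_pos (show 0 < sin φ * sinh s by positivity),
      abs_of_nonneg (show 0 ≤ cosh s - 1 by linarith [one_le_cosh s])]
    rw [div_le_div_iff₀ (by positivity) (by positivity)]
    have h1 := cosh_sub_one_le hs.le
    have h2 := abs_cos_le_one φ
    have h3 : |cos φ| * (cosh s - 1) ≤ s / 2 * sinh s := by
      have := one_le_cosh s
      calc |cos φ| * (cosh s - 1) ≤ 1 * (cosh s - 1) := by gcongr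
        _ ≤ _ := by linarith
    have := mul_le_mul_of_nonneg_right h3 (show 0 ≤ 2 * sin φ by positivity)
    linarith
  set x := sinh s / s with hx
  have hxs : sinh s = s * x := by rw [hx]; field_simp
  have hx1 : 1 ≤ x := by rw [hx, one_le_div hs]; exact self_le_sinh_iff.2 hs.le
  have hxe : x ≤ exp s := by
    rw [hx, div_le_iff₀ hs]
    have := sinh_le_mul_cosh hs.le
    have := mul_le_mul_of_nonneg_left (cosh_le_exp2 hs.le) hs.le
    linarith
  have hx2 : x - 1 ≤ s ^ 2 / 6 * exp s := by
    have h1 := sinh_sub_le hs.le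
    have h2 := mul_le_mul_of_nonneg_left (cosh_le_exp2 hs.le) (show 0 ≤ s ^ 3 / 6 by positivity)
    have : s * (x - 1) ≤ s * (s ^ 2 / 6 * exp s) := by
      rw [mul_sub, ← hxs]; linarith
    exact le_of_mul_le_mul_left this hs
  have hxp : x ^ p ≤ exp s := by
    calc x ^ p ≤ x ^ (1:ℝ) := rpow_le_rpow_of_exponent_le hx1 hp1
      _ = x := rpow_one x
      _ ≤ _ := hxe
  have hxp0 : 0 ≤ x ^ p := rpow_nonneg (by linarith) p
  have hsp : sinh s ^ p = s ^ p * x ^ p := by rw [hxs, mul_rpow hs.le (by linarith)]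
  have hA := abs_rpow_sub_one hx1 hp.le hp1
  have hB := norm_cpow_sub_one hp1 y
  have e : ((exp (-(N * s)) * sinh s ^ p : ℝ) : ℂ) * (1 + (y : ℂ) * Complex.I) ^ (p : ℂ) -
        ((s ^ p * exp (-(N * s)) : ℝ) : ℂ) =
      ((exp (-(N * s)) * s ^ p : ℝ) : ℂ) *
        (((x ^ p : ℝ) : ℂ) * ((1 + (y : ℂ) * Complex.I) ^ (p : ℂ) - 1) +
          ((x ^ p - 1 : ℝ) : ℂ)) := by
    rw [hsp]; simp only [Complex.ofReal_mul, Complex.ofReal_sub, Complex.ofReal_one]; ring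
  have hsp0 : 0 < s ^ p := rpow_pos_of_pos hs p
  rw [e, norm_mul, Complex.norm_real, Real.norm_eq_abs, abs_of_pos (by positivity)]
  have hn : ‖((x ^ p : ℝ) : ℂ) * ((1 + (y : ℂ) * Complex.I) ^ (p : ℂ) - 1) +
          ((x ^ p - 1 : ℝ) : ℂ)‖ ≤ exp s * (|p| * (s / (2 * sin φ))) + |p| * (s ^ 2 / 6 * exp s) := by
    refine (norm_add_le _ _).trans (add_le_add ?_ ?_)
    · rw [norm_mul, Complex.norm_real, Real.norm_eq_abs, abs_of_nonneg hxp0]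
      refine mul_le_mul hxp (hB.trans ?_) (norm_nonneg _) (exp_pos s).le
      gcongr
    · rw [Complex.norm_real, Real.norm_eq_abs]
      refine hA.trans ?_
      gcongr
  refine (mul_le_mul_of_nonneg_left hn (by positivity)).trans (le_of_eq ?_)
  have e1 : s ^ (p + 2 - 1) = s ^ p * s := by
    rw [show p + 2 - 1 = p + 1 by ring, rpow_add hs, rpow_one]
  have e2 : s ^ (p + 3 - 1) = s ^ p * s ^ 2 := by
    rw [show p + 3 - 1 = p + (2:ℕ) by push_cast; ring, rpow_add hs, rpow_natCast]
  have e3 : exp (-((N - 1) * s)) = exp (-(N * s)) * exp s := by rw [← exp_add]; ring_nf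
  rw [e1, e2, e3]
  field_simp

lemma gamma_integrable {a r : ℝ} (ha : 0 < a) (hr : 0 < r) :
    MeasureTheory.IntegrableOn (fun t : ℝ => t ^ (a - 1) * exp (-(r * t))) (Set.Ioi 0) := by
  have := integrableOn_rpow_mul_exp_neg_mul_rpow (p := 1) (s := a - 1) (b := r) (by linarith)
    one_pos hr
  simpa [neg_mul] using this

open MeasureTheory in
lemma mehler_est {N p φ : ℝ} (hN : 1 < N) (hp : -1 < p) (hp1 : p ≤ 1) (hφ : φ ∈ Set.Ioo 0 π) :
    |(∫ t in Set.Ioo 0 φ, cos (N * t) * (cos t - cos φ) ^ p) -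
      sin φ ^ p * ((1 / N) ^ (p + 1) * Gamma (p + 1)) * sin (N * φ - p * π / 2)| ≤
    sin φ ^ p * (|p| / (2 * sin φ) * ((1 / (N - 1)) ^ (p + 2) * Gamma (p + 2)) +
      |p| / 6 * ((1 / (N - 1)) ^ (p + 3) * Gamma (p + 3))) := by
  have hsin : 0 < sin φ := sin_pos_of_pos_of_lt_pi hφ.1 hφ.2
  have hsp : 0 < sin φ ^ p := rpow_pos_of_pos hsin p
  set E : ℂ := Complex.exp (((N * φ - p * π / 2 : ℝ) : ℂ) * Complex.I) with hE
  have hEn : ‖E‖ = 1 := Complex.norm_exp_ofReal_mul_I _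
  have hm : IntegrableOn (fun s : ℝ => s ^ p * exp (-(N * s))) (Set.Ioi 0) := by
    have := gamma_integrable (a := p + 1) (r := N) (by linarith) (by linarith)
    rwa [add_sub_cancel_right] at this
  have hmi : ∫ s in Set.Ioi (0:ℝ), s ^ p * exp (-(N * s)) = (1 / N) ^ (p + 1) * Gamma (p + 1) := by
    have := integral_rpow_mul_exp_neg_mul_Ioi (a := p + 1) (r := N) (by linarith) (by linarith)
    rwa [add_sub_cancel_right] at this
  have hb1 := gamma_integrable (a := p + 2) (r := N - 1) (by linarith) (by linarith)
  have hb2 := gamma_integrable (a := p + 3) (r := N - 1) (by linarith) (by linarith)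
  set M : ℝ → ℂ := fun s => ((sin φ ^ p : ℝ) : ℂ) * E * ((s ^ p * exp (-(N * s)) : ℝ) : ℂ) with hM
  have hMint : IntegrableOn M (Set.Ioi 0) := hm.ofReal.const_mul _
  set F : ℝ → ℂ := fun s => cf N p φ (φ + s * Complex.I) with hF
  set G : ℝ → ℝ := fun s => sin φ ^ p *
    (|p| / (2 * sin φ) * (s ^ (p + 2 - 1) * exp (-((N - 1) * s))) +
        |p| / 6 * (s ^ (p + 3 - 1) * exp (-((N - 1) * s)))) with hG
  have hGint : IntegrableOn G (Set.Ioi 0) := ((hb1.const_mul _).add (hb2.const_mul _)).const_mul _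
  have hGval : ∫ s in Set.Ioi (0:ℝ), G s =
      sin φ ^ p * (|p| / (2 * sin φ) * ((1 / (N - 1)) ^ (p + 2) * Gamma (p + 2)) +
      |p| / 6 * ((1 / (N - 1)) ^ (p + 3) * Gamma (p + 3))) := by
    rw [hG, integral_const_mul, integral_add (hb1.const_mul _) (hb2.const_mul _),
      integral_const_mul, integral_const_mul,
      integral_rpow_mul_exp_neg_mul_Ioi (by linarith) (by linarith),
      integral_rpow_mul_exp_neg_mul_Ioi (by linarith) (by linarith)]
  have hFc : ContinuousOn F (Set.Ioi 0) := by
    intro s hs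
    have h1 : ContinuousAt (cf N p φ) (φ + s * Complex.I) :=
      (cf_diffAt (cw_slit hφ ⟨hφ.1.le, le_rfl⟩ hs)).continuousAt
    have h2 : ContinuousAt (fun s : ℝ => (φ : ℂ) + s * Complex.I) s := by fun_prop
    exact (ContinuousAt.comp (f := fun s : ℝ => (φ : ℂ) + s * Complex.I) h1 h2).continuousWithinAt
  have hbd : ∀ s ∈ Set.Ioi (0:ℝ), ‖F s - M s‖ ≤ G s := by
    intro s hs
    have h := rem_bound (N := N) hp hp1 hφ hs
    simp only [hF, hM, hG]
    rw [cf_factor hφ hs, ← mul_sub, norm_mul, norm_mul, hEn, mul_one, Complex.norm_real,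
      Real.norm_eq_abs, abs_of_pos hsp]
    exact mul_le_mul_of_nonneg_left h hsp.le
  have hbd' : ∀ᵐ s ∂(volume.restrict (Set.Ioi (0:ℝ))), ‖F s - M s‖ ≤ G s :=
    (ae_restrict_iff' measurableSet_Ioi).2 (Filter.Eventually.of_forall hbd)
  have hDint : IntegrableOn (fun s => F s - M s) (Set.Ioi 0) := by
    refine Integrable.mono' hGint ?_ hbd'
    exact (hFc.aestronglyMeasurable measurableSet_Ioi).sub hMint.aestronglyMeasurable
  have hFint : IntegrableOn F (Set.Ioi 0) := by
    have := hDint.add hMint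
    refine this.congr (Filter.Eventually.of_forall fun s => ?_)
    simp
  have hn := norm_integral_le_of_norm_le hGint hbd'
  rw [hGval, integral_sub hFint hMint] at hn
  rw [contour hN hp hp1 hφ hFint]
  have hMval : (∫ s in Set.Ioi (0:ℝ), M s).im =
      sin φ ^ p * ((1 / N) ^ (p + 1) * Gamma (p + 1)) * sin (N * φ - p * π / 2) := by
    rw [hM, integral_const_mul, integral_complex_ofReal, hmi, Complex.im_mul_ofReal,
      Complex.im_ofReal_mul, hE, Complex.exp_ofReal_mul_I_im]
    ring
  rw [← hMval, ← Complex.sub_im]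
  exact (Complex.abs_im_le_norm _).trans hn

theorem ggf_uniform_bound_small_lambda (lam nu : ℝ) (hlam0 : 0 < lam) (hlam2 : lam ≤ 2)
    (hnu : 0 < nu) (hsum : 1 < nu + lam) (φ : ℝ) (hφ : φ ∈ Set.Ioo 0 π) :
    |Real.sin φ ^ lam * rG lam nu (Real.cos φ) -
        (2 ^ lam * Real.Gamma (lam + 1 / 2)) / (Real.sqrt π * (nu + lam) ^ lam) *
          Real.cos ((nu + lam) * φ - lam * π / 2)| ≤
      (lam * |lam - 1| * 2 ^ lam * Real.Gamma (lam + 1 / 2) / Real.sqrt π *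
          ((3 * nu + 5 * lam - 1) / (3 * (nu + lam - 1))) *
          Real.exp ((1 - lam ^ 2) / (nu + lam - 1))) /
        (nu ^ (lam + 1) * Real.sin φ) := by
  have hsin : 0 < sin φ := sin_pos_of_pos_of_lt_pi hφ.1 hφ.2
  have hsin1 : sin φ ≤ 1 := sin_le_one φ
  have hest := mehler_est (N := nu + lam) (p := lam - 1) hsum (by linarith) (by linarith) hφ
  rw [mehler hlam0 (by linarith) hφ] at hest
  rw [sub_add_cancel, show lam - 1 + 2 = lam + 1 by ring, show lam - 1 + 3 = lam + 1 + 1 by ring,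
    Gamma_add_one (show lam + 1 ≠ 0 by linarith), Gamma_add_one hlam0.ne',
    show (nu + lam) * φ - (lam - 1) * π / 2 = ((nu + lam) * φ - lam * π / 2) + π / 2 by ring,
    sin_add_pi_div_two] at hest
  set c := cos ((nu + lam) * φ - lam * π / 2)
  set μ := nu + lam - 1 with hμ
  have hμ0 : 0 < μ := by rw [hμ]; linarith
  have hG : 0 < Gamma lam := Gamma_pos_of_pos hlam0
  have hG2 : 0 < Gamma (lam + 1 / 2) := Gamma_pos_of_pos (by linarith)
  have h2 : (0:ℝ) < 2 ^ lam := by positivity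
  have hpi : 0 < √π := by positivity
  have hN : 0 < (nu + lam) ^ lam := rpow_pos_of_pos (by linarith) _
  have hs : 0 < sin φ ^ (lam - 1) := rpow_pos_of_pos hsin _
  have e1 : sin φ ^ (2 * lam - 1) = sin φ ^ (lam - 1) * sin φ ^ lam := by
    rw [← rpow_add hsin]; ring_nf
  have e2 : (1 / (nu + lam)) ^ lam = 1 / (nu + lam) ^ lam := by
    rw [div_rpow zero_le_one (by linarith), one_rpow]
  have hMp : 0 < μ ^ (lam + 1) := rpow_pos_of_pos hμ0 _
  have e3 : (1 / μ) ^ (lam + 1) = 1 / μ ^ (lam + 1) := by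
    rw [div_rpow zero_le_one hμ0.le, one_rpow]
  have e4 : (1 / μ) ^ (lam + 1 + 1) = 1 / μ ^ (lam + 1) * (1 / μ) := by
    rw [rpow_add (by positivity), rpow_one, e3]
  rw [e1, e2, e3, e4] at hest
  set K := 2 ^ lam * Gamma (lam + 1 / 2) / √π with hK
  have hK0 : 0 < K := by rw [hK]; positivity
  set f := K / (sin φ ^ (lam - 1) * Gamma lam) with hf
  have hf0 : 0 < f := by rw [hf]; positivity
  have key := mul_le_mul_of_nonneg_left hest hf0.le
  rw [← abs_of_pos hf0, ← abs_mul, abs_of_pos hf0] at key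
  have L1 : f * (√π * Gamma lam / (2 ^ lam * Gamma (lam + 1 / 2)) *
      (sin φ ^ (lam - 1) * sin φ ^ lam) * rG lam nu (cos φ) -
      sin φ ^ (lam - 1) * (1 / (nu + lam) ^ lam * Gamma lam) * c) =
      sin φ ^ lam * rG lam nu (cos φ) -
        (2 ^ lam * Gamma (lam + 1 / 2)) / (√π * (nu + lam) ^ lam) * c := by
    rw [hf, hK]; field_simp
  rw [L1] at key
  refine key.trans ?_
  have hnup : 0 < nu ^ (lam + 1) := rpow_pos_of_pos hnu _
  have L2 : nu ^ (lam + 1) ≤ μ ^ (lam + 1) * exp ((1 - lam ^ 2) / μ) := by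
    have h1 : nu ≤ μ * exp ((1 - lam) / μ) := by
      have := add_one_le_exp ((1 - lam) / μ)
      have := mul_le_mul_of_nonneg_left this hμ0.le
      have e : μ * ((1 - lam) / μ + 1) = nu := by field_simp; rw [hμ]; ring
      linarith
    have h2 := rpow_le_rpow hnu.le h1 (show 0 ≤ lam + 1 by linarith)
    rw [mul_rpow hμ0.le (exp_pos _).le, ← exp_mul] at h2
    convert h2 using 3
    ring
  have L3 : 1 / μ ^ (lam + 1) ≤ exp ((1 - lam ^ 2) / μ) / nu ^ (lam + 1) := by
    rw [div_le_div_iff₀ hMp hnup]; linarith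
  have L4 : 1 / (2 * sin φ) + (lam + 1) / (6 * μ) ≤
      ((3 * nu + 5 * lam - 1) / (3 * μ)) / sin φ := by
    have e : (3 * nu + 5 * lam - 1) / (3 * μ) = 1 + (2 * lam + 2) / (3 * μ) := by
      field_simp; rw [hμ]; ring
    rw [e, add_div 1]
    have h1 : 1 / (2 * sin φ) ≤ 1 / sin φ := by
      apply one_div_le_one_div_of_le hsin; linarith
    have h2 : (lam + 1) / (6 * μ) ≤ (2 * lam + 2) / (3 * μ) := by
      rw [div_le_div_iff₀ (by positivity) (by positivity)]; nlinarith
    have h3 : (2 * lam + 2) / (3 * μ) ≤ (2 * lam + 2) / (3 * μ) / sin φ :=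
      le_div_self (by positivity) hsin hsin1
    linarith
  have L5 := mul_le_mul_of_nonneg_left (mul_le_mul L3 L4 (by positivity) (by positivity))
    (show 0 ≤ K * lam * |lam - 1| by positivity)
  refine le_trans (le_of_eq ?_) (L5.trans (le_of_eq ?_))
  · rw [hf]; field_simp
  · rw [hK]; field_simp
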